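/- arXiv:2506.20565 — 2 statements merged into one kernel-verified Lean document; each statement's English description precedes it below -/
import Mathlib

section
/- Let f, g_1,…,g_r ∈ ℝ[X_1,…,X_n], let μ_0 > 0, and let x : (0,μ_0) → ℝ^n be a bounded critical path: x is continuous, its image is bounded, and for every μ ∈ (0,μ_0), x(μ) satisfies g_i(x(μ)) > 0 for all i, ∇f(x(μ)) = μ·Σ_{i=1}^r ∇g_i(x(μ))/g_i(x(μ)), and x(μ) is an isolated point of the set {y : g_i(y) > 0 ∀i and ∇f(y) = μ·Σ_{i=1}^r ∇g_i(y)/g_i(y)}. Then the limit x̄ = lim_{μ→0⁺} x(μ) exists, and there exist a positive integer γ, a constant C > 0, and μ_1 ∈ (0,μ_0) such that ‖x(μ) − x̄‖ ≤ C·μ^{1/γ} for all μ ∈ (0,μ_1). (Real-number form of the quantitative part of the theorem on the limiting behavior of a bounded critical path: convergence at rate O(μ^{1/γ}).) -/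
open MvPolynomial

theorem aux_integral {n : ℕ} {A Q : Type*} [CommRing A] [CommRing Q] [Algebra A Q]
    (y : Fin n → Q) (N : ℕ) (G : Fin n → MvPolynomial (Fin n) A)
    (hG : ∀ i, (G i).totalDegree < N) (hy : ∀ i, y i ^ N = aeval y (G i)) (j : Fin n) :
    IsIntegral A (y j) := by
  classical
  set S : Set (Fin n →₀ ℕ) := {m | m.degree ≤ n * N} with hS
  have hfin : S.Finite := Finsupp.finite_of_degree_le _
  set M : Submodule A Q := Submodule.span A ((fun m => aeval y (monomial m (1 : A))) '' S) with hM
  have key : ∀ k, ∀ p : MvPolynomial (Fin n) A, p.totalDegree ≤ k → aeval y p ∈ M := by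
    intro k
    induction k using Nat.strong_induction_on with
    | _ k ih =>
    intro p hp
    rw [p.as_sum, map_sum]
    refine Submodule.sum_mem _ fun m hm => ?_
    have hmk : m.degree ≤ k := (le_totalDegree hm).trans hp
    have hsm : monomial m (coeff m p) = (coeff m p) • monomial m (1 : A) := by
      rw [smul_monomial]; simp
    rw [hsm, map_smul]
    refine Submodule.smul_mem _ _ ?_
    by_cases hmS : m.degree ≤ n * N
    · exact Submodule.subset_span ⟨m, hmS, rfl⟩
    · obtain ⟨i, hi⟩ : ∃ i, N ≤ m i := by
        by_contra hcon
        push Not at hcon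
        apply hmS
        rw [Finsupp.degree_eq_sum]
        calc ∑ i, m i ≤ ∑ _i : Fin n, N := Finset.sum_le_sum fun i _ => (hcon i).le
          _ = n * N := by simp
      have hle : Finsupp.single i N ≤ m := by
        rw [Finsupp.single_le_iff]; exact hi
      obtain ⟨m', rfl⟩ := exists_add_of_le hle
      have hdeg : (Finsupp.single i N + m').degree = N + m'.degree := by
        rw [map_add]; simp
      have e : aeval y (monomial (Finsupp.single i N + m') (1 : A))
          = aeval y (G i * monomial m' (1 : A)) := by
        rw [map_mul, ← hy, ← mul_one (1 : A), ← monomial_mul, map_mul]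
        congr 1
        · simp [aeval_monomial]
        · simp
      rw [e]
      have h2 : (monomial m' (1 : A)).totalDegree ≤ m'.degree := totalDegree_monomial_le _ _
      have h1 := totalDegree_mul (G i) (monomial m' (1 : A))
      have h3 := hG i
      exact ih (k - 1) (by omega) _ (by omega)
  have hle : (aeval y : MvPolynomial (Fin n) A →ₐ[A] Q).range.toSubmodule = M := by
    apply le_antisymm
    · rintro _ ⟨p, rfl⟩
      exact key _ p le_rfl
    · rw [hM, Submodule.span_le]
      rintro _ ⟨m, _, rfl⟩
      exact ⟨_, rfl⟩
  refine IsIntegral.of_mem_of_fg (aeval y : MvPolynomial (Fin n) A →ₐ[A] Q).range ?_ _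
    ⟨X j, by simp⟩
  rw [hle]
  exact Submodule.fg_span (hfin.image _)

theorem aux_swap {R : Type*} [CommRing R] (ψ : R →+* ℝ) (s t : ℝ)
    (p : Polynomial (Polynomial R)) :
    Polynomial.eval₂ (Polynomial.eval₂RingHom ψ s) t p =
      ∑ d ∈ Finset.range ((Polynomial.Bivariate.swap p).natDegree + 1),
        Polynomial.eval₂ ψ t ((Polynomial.Bivariate.swap p).coeff d) * s ^ d := by
  have h : ∀ p : Polynomial (Polynomial R), Polynomial.eval₂ (Polynomial.eval₂RingHom ψ s) t p
      = Polynomial.eval₂ (Polynomial.eval₂RingHom ψ t) s (Polynomial.Bivariate.swap p) := by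
    intro p
    induction p using Polynomial.induction_on' with
    | add p q hp hq => simp only [Polynomial.eval₂_add, map_add, hp, hq]
    | monomial k a =>
      induction a using Polynomial.induction_on' with
      | add p q hp hq => simp only [Polynomial.eval₂_add, map_add, hp, hq]
      | monomial l a =>
        rw [Polynomial.Bivariate.swap_monomial_monomial]
        simp
        ring
  rw [h, Polynomial.eval₂_eq_sum_range]
  simp

theorem aux_lim (D : ℕ) (c : ℕ → Polynomial ℝ) (s t : ℕ → ℝ) (t0 : ℝ)
    (hs : Filter.Tendsto s Filter.atTop Filter.atTop)
    (ht : Filter.Tendsto t Filter.atTop (nhds t0))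
    (h : ∀ k, ∑ d ∈ Finset.range (D + 1), (c d).eval (t k) * s k ^ d = 0) :
    (c D).eval t0 = 0 := by
  have h1 : Filter.Tendsto (fun k => (c D).eval (t k)) Filter.atTop (nhds ((c D).eval t0)) :=
    ((c D).continuous.tendsto t0).comp ht
  have h2 : Filter.Tendsto (fun k => -∑ d ∈ Finset.range D, (c d).eval (t k) * ((s k)⁻¹) ^ (D - d))
      Filter.atTop (nhds (-∑ d ∈ Finset.range D, (c d).eval t0 * 0 ^ (D - d))) := by
    refine (tendsto_finsetSum _ fun d _ => ?_).neg
    exact (((c d).continuous.tendsto t0).comp ht).mul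
      ((tendsto_inv_atTop_zero.comp hs).pow _)
  have h3 : -∑ d ∈ Finset.range D, (c d).eval t0 * 0 ^ (D - d) = 0 := by
    rw [neg_eq_zero]
    refine Finset.sum_eq_zero fun d hd => ?_
    rw [Finset.mem_range] at hd
    rw [zero_pow (by omega), mul_zero]
  rw [h3] at h2
  refine tendsto_nhds_unique h1 (h2.congr' ?_)
  filter_upwards [hs.eventually_gt_atTop 0] with k hk
  have := h k
  rw [Finset.sum_range_succ] at this
  have h4 : (∑ d ∈ Finset.range D, (c d).eval (t k) * ((s k)⁻¹) ^ (D - d)) * s k ^ D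
      = ∑ d ∈ Finset.range D, (c d).eval (t k) * s k ^ d := by
    rw [Finset.sum_mul]
    refine Finset.sum_congr rfl fun d hd => ?_
    rw [Finset.mem_range] at hd
    have : s k ^ D = s k ^ (D - d) * s k ^ d := by rw [← pow_add]; congr 1; omega
    rw [this, inv_pow]
    have := pow_pos hk (D - d)
    field_simp
  rw [← h4] at this
  have h5 := pow_pos hk D
  have h6 : ((∑ d ∈ Finset.range D, (c d).eval (t k) * ((s k)⁻¹) ^ (D - d)) + (c D).eval (t k)) * s k ^ D = 0 := by
    rw [add_mul]; exact this
  rcases mul_eq_zero.1 h6 with h | h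
  · linarith
  · exact absurd h h5.ne'

theorem aux_deriv {n : ℕ} (p : MvPolynomial (Fin n) ℝ) (y : Fin n → ℝ) (i : Fin n) :
    HasDerivAt (fun t => eval (Function.update y i t) p) (eval y (pderiv i p)) (y i) := by
  induction p using MvPolynomial.induction_on with
  | C a => simpa using hasDerivAt_const (y i) a
  | add p q hp hq => simp only [map_add]; exact hp.add hq
  | mul_X p j hp =>
    have hX : HasDerivAt (fun t => Function.update y i t j) (eval y (pderiv i (X j : MvPolynomial (Fin n) ℝ))) (y i) := by
      by_cases hij : j = i
      · subst hij; simpa using hasDerivAt_id' (y j)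
      · simpa [hij, pderiv_X_of_ne (Ne.symm (Ne.symm hij))] using hasDerivAt_const (y i) (y j)
    have := hp.mul hX
    simp only [map_mul, eval_X]
    have e : eval y (pderiv i (p * X j)) = (eval y) ((pderiv i) p) * Function.update y i (y i) j +
      (eval (Function.update y i (y i))) p * (eval y) ((pderiv i) (X j)) := by
      rw [Derivation.leibniz]
      simp
      ring
    rw [e]
    exact this

theorem aux_min {n : ℕ} (Φ : MvPolynomial (Fin n) ℝ) (N : ℕ) (hN : Odd N)
    (hpos : ∀ y, 0 ≤ eval y Φ) (y0 : Fin n → ℝ) (h0 : eval y0 Φ = 0) (δ : ℝ)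
    (hiso : ∀ y, eval y Φ = 0 → dist y y0 < δ → y = y0) (η : ℝ) (hη : 0 < η) (hηδ : η < δ) :
    ∃ s0 : ℝ, ∀ s ≥ s0, ∃ y, dist y y0 ≤ η ∧ ∀ i, y i ^ N = - s * eval y (pderiv i Φ) := by
  have hcont : Continuous fun y => eval y Φ := MvPolynomial.continuous_eval Φ
  obtain ⟨m, hm, hmin⟩ := (isCompact_sphere y0 η).exists_forall_le' (f := fun y => eval y Φ)
    (a := 0) hcont.continuousOn (by
      intro b hb
      refine lt_of_le_of_ne (hpos b) fun h => ?_
      have hb' : dist b y0 = η := hb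
      have := hiso b h.symm (by rw [hb']; exact hηδ)
      rw [this, dist_self] at hb'
      exact hη.ne hb')
  have hN1 : Even (N + 1) := hN.add_one
  set E : (Fin n → ℝ) → ℝ := fun y => ∑ i, y i ^ (N + 1) / (N + 1) with hE
  have hEpos : ∀ y, 0 ≤ E y := fun y => Finset.sum_nonneg fun i _ => by
    have := hN1.pow_nonneg (y i)
    positivity
  refine ⟨(E y0 + 1) / m, fun s hs => ?_⟩
  have hs' : E y0 + 1 ≤ s * m := by rwa [ge_iff_le, div_le_iff₀ hm] at hs
  set H : MvPolynomial (Fin n) ℝ := C s * Φ + ∑ i, C (1 / ((N : ℝ) + 1)) * X i ^ (N + 1) with hH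
  have hHe : ∀ y, eval y H = s * eval y Φ + E y := by
    intro y
    simp [hH, hE, div_eq_inv_mul]
  obtain ⟨y, hyb, hymin⟩ := (isCompact_closedBall y0 η).exists_isMinOn
    ⟨y0, Metric.mem_closedBall_self hη.le⟩ (MvPolynomial.continuous_eval H).continuousOn
  have hlt : dist y y0 < η := by
    refine lt_of_le_of_ne hyb fun h => ?_
    have h1 : eval y H ≤ eval y0 H := hymin (Metric.mem_closedBall_self hη.le)
    rw [hHe, hHe, h0, mul_zero, zero_add] at h1
    have h2 := hmin y h
    have h3 := hEpos y
    have hs0 : 0 ≤ s := by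
      have := hEpos y0
      by_contra hneg
      push Not at hneg
      nlinarith
    have := mul_le_mul_of_nonneg_left h2 hs0
    linarith
  refine ⟨y, hlt.le, fun i => ?_⟩
  have hloc : IsLocalMin (fun z => eval z H) y :=
    hymin.isLocalMin (Filter.mem_of_superset (Metric.isOpen_ball.mem_nhds hlt)
      Metric.ball_subset_closedBall)
  have hup : Filter.Tendsto (fun t => Function.update y i t) (nhds (y i)) (nhds y) := by
    have : Continuous fun t => Function.update y i t := continuous_const.update i continuous_id
    simpa using this.tendsto (y i)
  have hloc2 : IsLocalMin (fun t => eval (Function.update y i t) H) (y i) := by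
    have := hup.eventually hloc
    filter_upwards [this] with t ht
    simpa using ht
  have hz := hloc2.hasDerivAt_eq_zero (aux_deriv H y i)
  have hc : eval y (pderiv i H) = s * eval y (pderiv i Φ) + y i ^ N := by
    rw [hH, map_add, map_sum, map_add, pderiv_C_mul]
    congr 1
    · simp
    · rw [map_sum, Finset.sum_eq_single i]
      · rw [pderiv_C_mul, pderiv_pow]
        have : ((N : ℝ) + 1) ≠ 0 := by positivity
        simp
        field_simp
      · intro j _ hj
        rw [pderiv_C_mul, pderiv_pow, pderiv_X_of_ne hj]
        simp
      · simp
  rw [hc] at hz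
  linarith

theorem aux_integral2 {n : ℕ} {A : Type*} [CommRing A] (N : ℕ)
    (G : Fin n → MvPolynomial (Fin n) A) (hG : ∀ i, (G i).totalDegree < N) (j : Fin n) :
    ∃ p : Polynomial A, p.Monic ∧ ∀ (φ : A →+* ℝ) (z : Fin n → ℝ),
      (∀ i, z i ^ N = eval₂ φ z (G i)) → Polynomial.eval₂ φ (z j) p = 0 := by
  let I : Ideal (MvPolynomial (Fin n) A) := Ideal.span (Set.range fun i => X i ^ N - G i)
  let y : Fin n → MvPolynomial (Fin n) A ⧸ I := fun i => Ideal.Quotient.mk I (X i)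
  have hae : ∀ q, aeval y q = Ideal.Quotient.mk I q := by
    intro q
    have : (aeval y : MvPolynomial (Fin n) A →ₐ[A] _) = Ideal.Quotient.mkₐ _ I := by
      ext i
      simp [y]
    rw [this]; rfl
  obtain ⟨p, hpm, hp0⟩ := aux_integral y N G hG (fun i => by
    rw [hae, ← map_pow, Ideal.Quotient.mk_eq_mk_iff_sub_mem]
    exact Ideal.subset_span ⟨i, rfl⟩) j
  refine ⟨p, hpm, fun φ z hz => ?_⟩
  let θ : MvPolynomial (Fin n) A →+* ℝ := eval₂Hom φ z
  have hI : ∀ a ∈ I, θ a = 0 := by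
    have : I ≤ RingHom.ker θ := by
      rw [Ideal.span_le]
      rintro _ ⟨i, rfl⟩
      have e3 : θ (X i) = z i := by simp [θ]
      change θ (X i ^ N - G i) = 0
      rw [map_sub, map_pow, e3, hz i]
      exact sub_self _
    exact fun a ha => this ha
  let L := Ideal.Quotient.lift I θ hI
  have h1 := congrArg L hp0
  rw [Polynomial.hom_eval₂, map_zero] at h1
  have h2 : L.comp (algebraMap A _) = φ := by
    refine RingHom.ext fun a => ?_
    change L (Ideal.Quotient.mk I (C a)) = _
    rw [Ideal.Quotient.lift_mk]
    simp [θ]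
  have h3 : L (y j) = z j := by
    change L (Ideal.Quotient.mk I (X j)) = _
    rw [Ideal.Quotient.lift_mk]
    simp [θ]
  rw [h2, h3] at h1
  exact h1

theorem aux_alg {n : ℕ} (F : MvPolynomial (Fin n) (Polynomial ℝ)) (j : Fin n) :
    ∃ P : Polynomial (Polynomial ℝ), P ≠ 0 ∧ ∀ (μ : ℝ) (y0 : Fin n → ℝ) (δ : ℝ), 0 < δ →
      (∀ y, 0 ≤ eval y (map (Polynomial.evalRingHom μ) F)) →
      eval y0 (map (Polynomial.evalRingHom μ) F) = 0 →
      (∀ y, eval y (map (Polynomial.evalRingHom μ) F) = 0 → dist y y0 < δ → y = y0) →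
      Polynomial.eval₂ (Polynomial.evalRingHom μ) (y0 j) P = 0 := by
  classical
  set N := 2 * (∑ i, (pderiv i F).totalDegree) + 1 with hN
  have hNodd : Odd N := ⟨_, rfl⟩
  let G : Fin n → MvPolynomial (Fin n) (Polynomial (Polynomial ℝ)) := fun i =>
    C (-Polynomial.X) * map Polynomial.C (pderiv i F)
  have hG : ∀ i, (G i).totalDegree < N := by
    intro i
    have h1 := totalDegree_mul (C (-Polynomial.X)) (map Polynomial.C (pderiv i F))
    have h2 : (map Polynomial.C (pderiv i F)).totalDegree ≤ (pderiv i F).totalDegree :=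
      Finset.sup_mono (support_map_subset _ _)
    have h3 : (pderiv i F).totalDegree ≤ ∑ i, (pderiv i F).totalDegree :=
      Finset.single_le_sum (f := fun i => (pderiv i F).totalDegree)
        (fun _ _ => Nat.zero_le _) (Finset.mem_univ i)
    rw [totalDegree_C] at h1
    change (C (-Polynomial.X) * map Polynomial.C (pderiv i F)).totalDegree < N
    omega
  obtain ⟨p, hpm, hp0⟩ := aux_integral2 N G hG j
  have hev : ∀ (μ s : ℝ) (z : Fin n → ℝ),
      (∀ i, z i ^ N = - s * eval z (pderiv i (map (Polynomial.evalRingHom μ) F))) →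
      Polynomial.eval₂ (Polynomial.eval₂RingHom (Polynomial.evalRingHom μ) s) (z j) p = 0 := by
    intro μ s z hz
    refine hp0 _ z fun i => ?_
    have hφC : (Polynomial.eval₂RingHom (Polynomial.evalRingHom μ) s).comp Polynomial.C
        = Polynomial.evalRingHom μ := by
      ext <;> simp
    change _ = eval₂ _ z (C (-Polynomial.X) * map Polynomial.C (pderiv i F))
    rw [eval₂_mul, eval₂_map, hφC, hz i, pderiv_map, eval_map]
    simp
  have hq : Polynomial.Bivariate.swap p ≠ 0 := by
    simpa using hpm.ne_zero
  refine ⟨(Polynomial.Bivariate.swap p).leadingCoeff, by simpa using hpm.ne_zero, ?_⟩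
  intro μ y0 δ hδ hpos h0 hiso
  have hex : ∀ k : ℕ, ∃ (s : ℝ) (z : Fin n → ℝ), (k : ℝ) ≤ s ∧ dist z y0 ≤ δ / (k + 2) ∧
      ∀ i, z i ^ N = - s * eval z (pderiv i (map (Polynomial.evalRingHom μ) F)) := by
    intro k
    have hk : (0 : ℝ) < k + 2 := by positivity
    obtain ⟨s0, hs0⟩ := aux_min _ N hNodd hpos y0 h0 δ hiso (δ / (k + 2)) (by positivity)
      (by rw [div_lt_iff₀ hk]; nlinarith [(Nat.cast_nonneg k : (0 : ℝ) ≤ k)])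
    obtain ⟨z, hz1, hz2⟩ := hs0 (max s0 k) (le_max_left _ _)
    exact ⟨max s0 k, z, le_max_right _ _, hz1, hz2⟩
  choose s z hs hz1 hz2 using hex
  have hst : Filter.Tendsto s Filter.atTop Filter.atTop :=
    Filter.tendsto_atTop_mono hs tendsto_natCast_atTop_atTop
  have hzt : Filter.Tendsto z Filter.atTop (nhds y0) := by
    rw [tendsto_iff_dist_tendsto_zero]
    refine squeeze_zero (fun _ => dist_nonneg) hz1 ?_
    exact Filter.Tendsto.div_atTop tendsto_const_nhds
      (Filter.tendsto_atTop_add_const_right _ _ tendsto_natCast_atTop_atTop)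
  have := aux_lim (Polynomial.Bivariate.swap p).natDegree
    (fun d => ((Polynomial.Bivariate.swap p).coeff d).map (Polynomial.evalRingHom μ))
    s (fun k => z k j) (y0 j) hst ((continuous_apply j).continuousAt.tendsto.comp hzt) (by
      intro k
      have h1 := hev μ (s k) (z k) (hz2 k)
      rw [aux_swap] at h1
      simpa only [Polynomial.eval_map] using h1)
  rwa [Polynomial.eval_map] at this

theorem aux_rate (μ0 : ℝ) (hμ0 : 0 < μ0) (u : ℝ → ℝ) (hu : ContinuousOn u (Set.Ioo 0 μ0))
    (R : ℝ) (hR : ∀ μ ∈ Set.Ioo (0 : ℝ) μ0, |u μ| ≤ R)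
    (P : Polynomial (Polynomial ℝ)) (hP : P ≠ 0)
    (hPu : ∀ μ ∈ Set.Ioo (0 : ℝ) μ0,
      Polynomial.eval₂ (Polynomial.evalRingHom μ) (u μ) P = 0) :
    ∃ c : ℝ, Filter.Tendsto u (nhdsWithin 0 (Set.Ioi 0)) (nhds c) ∧
      ∃ m : ℕ, 0 < m ∧ ∃ K : ℝ, 0 < K ∧
        ∀ᶠ μ in nhdsWithin (0 : ℝ) (Set.Ioi 0), |u μ - c| ^ m ≤ K * μ := by
  have hIoo : ∀ᶠ μ in nhdsWithin (0 : ℝ) (Set.Ioi 0), μ ∈ Set.Ioo 0 μ0 :=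
    Ioo_mem_nhdsGT hμ0
  have hQ : Polynomial.Bivariate.swap P ≠ 0 := by simpa using hP
  obtain ⟨q, hq, hnd⟩ := Polynomial.exists_eq_pow_rootMultiplicity_mul_and_not_dvd _ hQ 0
  rw [Polynomial.C_0, sub_zero] at hq hnd
  rw [Polynomial.X_dvd_iff] at hnd
  have hqe : ∀ μ ∈ Set.Ioo (0 : ℝ) μ0, q.evalEval (u μ) μ = 0 := by
    intro μ hμ
    have h1 : (Polynomial.Bivariate.swap P).evalEval (u μ) μ = 0 := by
      have := Polynomial.Bivariate.aevalAeval_swap (u μ) μ P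
      rw [Polynomial.coe_aevalAeval_eq_evalEval, Polynomial.coe_aevalAeval_eq_evalEval] at this
      rw [this, ← Polynomial.eval₂_evalRingHom]
      exact hPu μ hμ
    rw [hq, Polynomial.evalEval_mul, Polynomial.evalEval_pow, Polynomial.evalEval_X] at h1
    rcases mul_eq_zero.1 h1 with h | h
    · exact absurd h (pow_ne_zero _ hμ.1.ne')
    · exact h
  set q0 := q.coeff 0 with hq0
  have hq0e : ∀ μ ∈ Set.Ioo (0 : ℝ) μ0, q0.eval (u μ) = - (q.divX.evalEval (u μ) μ * μ) := by
    intro μ hμ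
    have h1 := hqe μ hμ
    rw [← Polynomial.divX_mul_X_add q, Polynomial.evalEval_add, Polynomial.evalEval_mul,
      Polynomial.evalEval_X, Polynomial.evalEval_C] at h1
    linarith
  have hcont : Continuous fun z : ℝ × ℝ => q.divX.evalEval z.1 z.2 := by
    have : (fun z : ℝ × ℝ => q.divX.evalEval z.1 z.2) = fun z : ℝ × ℝ =>
        ∑ i ∈ Finset.range (q.divX.natDegree + 1), (q.divX.coeff i).eval z.1 * z.2 ^ i := by
      ext z
      rw [← Polynomial.eval₂_evalRingHom, Polynomial.eval₂_eq_sum_range]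
      simp
    rw [this]
    refine continuous_finsetSum _ fun i _ => ?_
    exact ((q.divX.coeff i).continuous.comp continuous_fst).mul (continuous_snd.pow i)
  obtain ⟨B, hB⟩ := ((isCompact_Icc (a := -R) (b := R)).prod
    (isCompact_Icc (a := (0 : ℝ)) (b := μ0))).exists_bound_of_continuousOn hcont.continuousOn
  have hbound : ∀ μ ∈ Set.Ioo (0 : ℝ) μ0, |q0.eval (u μ)| ≤ B * μ := by
    intro μ hμ
    rw [hq0e μ hμ, abs_neg, abs_mul, abs_of_pos hμ.1]
    refine mul_le_mul_of_nonneg_right ?_ hμ.1.le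
    exact hB (u μ, μ) ⟨abs_le.1 (hR μ hμ), hμ.1.le, hμ.2.le⟩
  have hid : Filter.Tendsto (fun μ : ℝ => μ) (nhdsWithin 0 (Set.Ioi 0)) (nhds 0) :=
    tendsto_nhdsWithin_of_tendsto_nhds Filter.tendsto_id
  have hlim0 : Filter.Tendsto (fun μ => q0.eval (u μ)) (nhdsWithin 0 (Set.Ioi 0)) (nhds 0) := by
    refine squeeze_zero_norm' (a := fun μ => B * μ) ?_ ?_
    · filter_upwards [hIoo] with μ hμ using hbound μ hμ
    · simpa using hid.const_mul B
  obtain ⟨c, hc⟩ : ∃ c, Filter.Tendsto u (nhdsWithin 0 (Set.Ioi 0)) (nhds c) := by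
    refine tendsto_of_no_upcrossings dense_univ ?_ ?_ ?_
    · rintro a - b - hab ⟨ha, hb⟩
      obtain ⟨d, hd, hdq⟩ : ∃ d ∈ Set.Ioo a b, q0.eval d ≠ 0 := by
        by_contra hcon
        push Not at hcon
        exact hnd (Polynomial.eq_zero_of_infinite_isRoot _
          ((Set.Ioo_infinite hab).mono fun d hd => hcon d hd))
      have hev : ∀ᶠ μ in nhdsWithin (0 : ℝ) (Set.Ioi 0), |q0.eval (u μ)| < |q0.eval d| := by
        have := hlim0.abs
        rw [abs_zero] at this
        exact this.eventually_lt_const (abs_pos.2 hdq)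
      obtain ⟨e, he, hee⟩ := (mem_nhdsGT_iff_exists_Ioo_subset).1 (hev.and hIoo)
      have hIe : ∀ᶠ μ in nhdsWithin (0 : ℝ) (Set.Ioi 0), μ ∈ Set.Ioo 0 e := Ioo_mem_nhdsGT he
      obtain ⟨μa, hua, hμa⟩ := (ha.and_eventually hIe).exists
      obtain ⟨μb, hub, hμb⟩ := (hb.and_eventually hIe).exists
      have hpre : IsPreconnected (Set.Ioo (0 : ℝ) e) := isPreconnected_Ioo
      have := hpre.intermediate_value hμa hμb (hu.mono fun μ hμ => (hee hμ).2)
      obtain ⟨ν, hν, hνd⟩ := this ⟨(hua.trans hd.1).le, (hd.2.trans hub).le⟩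
      have := (hee hν).1
      rw [hνd] at this
      exact lt_irrefl _ this
    · exact Filter.isBoundedUnder_of_eventually_le (a := R)
        (by filter_upwards [hIoo] with μ hμ using (abs_le.1 (hR μ hμ)).2)
    · exact Filter.isBoundedUnder_of_eventually_ge (a := -R)
        (by filter_upwards [hIoo] with μ hμ using (abs_le.1 (hR μ hμ)).1)
  refine ⟨c, hc, ?_⟩
  have hroot : q0.eval c = 0 :=
    tendsto_nhds_unique ((q0.continuous.tendsto c).comp hc) hlim0
  obtain ⟨v, hv, hvd⟩ := Polynomial.exists_eq_pow_rootMultiplicity_mul_and_not_dvd q0 hnd c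
  rw [Polynomial.dvd_iff_isRoot] at hvd
  have hvc : 0 < |v.eval c| := abs_pos.2 hvd
  refine ⟨q0.rootMultiplicity c, (Polynomial.rootMultiplicity_pos hnd).2 hroot,
    (|B| + 1) * (2 / |v.eval c|), by positivity, ?_⟩
  have hvl : ∀ᶠ μ in nhdsWithin (0 : ℝ) (Set.Ioi 0), |v.eval c| / 2 < |v.eval (u μ)| :=
    ((v.continuous.tendsto c).comp hc).abs.eventually_const_lt (by linarith)
  filter_upwards [hvl, hIoo] with μ h1 h2
  have h3 := hbound μ h2
  have h4 : |q0.eval (u μ)| = |u μ - c| ^ (q0.rootMultiplicity c) * |v.eval (u μ)| := by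
    conv_lhs => rw [hv]
    simp [abs_mul, abs_pow]
  rw [h4] at h3
  have h5 : |u μ - c| ^ (q0.rootMultiplicity c) * (|v.eval c| / 2) ≤ (|B| + 1) * μ := by
    refine (mul_le_mul_of_nonneg_left h1.le (by positivity)).trans (h3.trans ?_)
    exact mul_le_mul_of_nonneg_right (by linarith [le_abs_self B]) h2.1.le
  have h6 : (|B| + 1) * (2 / |v.eval c|) * μ = ((|B| + 1) * μ) / (|v.eval c| / 2) := by
    field_simp
  rw [h6, le_div_iff₀ (by positivity)]
  exact h5

theorem bounded_critical_path_convergence_rate (n r : ℕ) (f : MvPolynomial (Fin n) ℝ)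
    (g : Fin r → MvPolynomial (Fin n) ℝ) (μ0 : ℝ) (hμ0 : 0 < μ0)
    (x : ℝ → Fin n → ℝ) (hcont : ContinuousOn x (Set.Ioo 0 μ0))
    (hbdd : ∃ R : ℝ, ∀ μ ∈ Set.Ioo (0 : ℝ) μ0, ‖x μ‖ ≤ R)
    (hpath : ∀ μ ∈ Set.Ioo (0 : ℝ) μ0,
      (∀ i, 0 < eval (x μ) (g i)) ∧
      (∀ j, eval (x μ) (pderiv j f) =
        μ * ∑ i, eval (x μ) (pderiv j (g i)) / eval (x μ) (g i)) ∧
      ∃ δ > (0 : ℝ), ∀ y : Fin n → ℝ,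
        ((∀ i, 0 < eval y (g i)) ∧
          ∀ j, eval y (pderiv j f) = μ * ∑ i, eval y (pderiv j (g i)) / eval y (g i)) →
        dist y (x μ) < δ → y = x μ) :
    ∃ xb : Fin n → ℝ, Filter.Tendsto x (nhdsWithin 0 (Set.Ioi 0)) (nhds xb) ∧
      ∃ γ : ℕ, 0 < γ ∧ ∃ C : ℝ, 0 < C ∧ ∃ μ1 ∈ Set.Ioo (0 : ℝ) μ0,
        ∀ μ ∈ Set.Ioo (0 : ℝ) μ1, ‖x μ - xb‖ ≤ C * μ ^ (1 / (γ : ℝ)) := by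
  classical
  obtain ⟨R, hR⟩ := hbdd
  let c : MvPolynomial (Fin n) ℝ →+* MvPolynomial (Fin n) (Polynomial ℝ) := map Polynomial.C
  let F : MvPolynomial (Fin n) (Polynomial ℝ) := ∑ j, (c (pderiv j f) * ∏ i, c (g i) -
    C Polynomial.X * ∑ i, c (pderiv j (g i)) * ∏ k ∈ Finset.univ.erase i, c (g k)) ^ 2
  have hF : ∀ (μ : ℝ) (y : Fin n → ℝ), eval y (map (Polynomial.evalRingHom μ) F) =
      ∑ j, (eval y (pderiv j f) * ∏ i, eval y (g i) - μ * ∑ i, eval y (pderiv j (g i)) *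
        ∏ k ∈ Finset.univ.erase i, eval y (g k)) ^ 2 := by
    intro μ y
    have hc : ∀ q : MvPolynomial (Fin n) ℝ, eval y (map (Polynomial.evalRingHom μ) (c q)) =
        eval y q := by
      intro q
      have : (Polynomial.evalRingHom μ).comp Polynomial.C = RingHom.id ℝ := by ext; simp
      simp only [c]
      rw [map_map, this, map_id]
    simp only [F, map_sum, map_pow, map_sub, map_mul, map_prod, hc]
    simp
  have hpos : ∀ (μ : ℝ) (y : Fin n → ℝ), 0 ≤ eval y (map (Polynomial.evalRingHom μ) F) := by
    intro μ y
    rw [hF]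
    positivity
  have hiff : ∀ (μ : ℝ) (y : Fin n → ℝ), (∀ i, 0 < eval y (g i)) →
      (eval y (map (Polynomial.evalRingHom μ) F) = 0 ↔
        ∀ j, eval y (pderiv j f) = μ * ∑ i, eval y (pderiv j (g i)) / eval y (g i)) := by
    intro μ y hy
    rw [hF, Finset.sum_eq_zero_iff_of_nonneg (fun _ _ => sq_nonneg _)]
    have hpr : (∏ i, eval y (g i)) ≠ 0 := Finset.prod_ne_zero_iff.2 fun i _ => (hy i).ne'
    have hs : ∀ j, ∑ i, eval y (pderiv j (g i)) * ∏ k ∈ Finset.univ.erase i, eval y (g k)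
        = (∑ i, eval y (pderiv j (g i)) / eval y (g i)) * ∏ i, eval y (g i) := by
      intro j
      rw [Finset.sum_mul]
      refine Finset.sum_congr rfl fun i _ => ?_
      rw [← Finset.mul_prod_erase Finset.univ (fun i => eval y (g i)) (Finset.mem_univ i)]
      have := (hy i).ne'
      field_simp
    refine ⟨fun h j => ?_, fun h j _ => ?_⟩
    · have h1 := h j (Finset.mem_univ j)
      rw [hs, sq_eq_zero_iff, ← mul_assoc, ← sub_mul] at h1
      rcases mul_eq_zero.1 h1 with h2 | h2
      · linarith
      · exact absurd h2 hpr
    · rw [hs, h j]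
      ring
  have hcoord : ∀ j, ∃ c : ℝ, Filter.Tendsto (fun μ => x μ j) (nhdsWithin 0 (Set.Ioi 0)) (nhds c) ∧
      ∃ m : ℕ, 0 < m ∧ ∃ K : ℝ, 0 < K ∧
        ∀ᶠ μ in nhdsWithin (0 : ℝ) (Set.Ioi 0), |x μ j - c| ^ m ≤ K * μ := by
    intro j
    obtain ⟨P, hP0, hP⟩ := aux_alg F j
    refine aux_rate μ0 hμ0 (fun μ => x μ j)
      ((continuous_apply j).comp_continuousOn hcont) R
      (fun μ hμ => (norm_le_pi_norm (x μ) j).trans (hR μ hμ)) P hP0 ?_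
    intro μ hμ
    obtain ⟨h1, h2, δ, hδ, h3⟩ := hpath μ hμ
    have hopen : IsOpen {y : Fin n → ℝ | ∀ i, 0 < eval y (g i)} := by
      simp only [Set.ofPred_forall]
      exact isOpen_iInter_of_finite fun i =>
        isOpen_lt continuous_const (MvPolynomial.continuous_eval (g i))
    obtain ⟨ε, hε, hball⟩ := Metric.isOpen_iff.1 hopen (x μ) h1
    refine hP μ (x μ) (min δ ε) (lt_min hδ hε) (hpos μ) ((hiff μ _ h1).2 h2) ?_
    intro y hy hd
    have hyg : ∀ i, 0 < eval y (g i) := hball (lt_of_lt_of_le hd (min_le_right _ _))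
    exact h3 y ⟨hyg, (hiff μ y hyg).1 hy⟩ (lt_of_lt_of_le hd (min_le_left _ _))
  choose xb hxb m hm K hK hev using hcoord
  refine ⟨xb, tendsto_pi_nhds.2 hxb, (∑ j, m j) + 1, Nat.succ_pos _, 1 + ∑ j, (K j + 1), ?_, ?_⟩
  · have : 0 ≤ ∑ j, (K j + 1) := Finset.sum_nonneg fun j _ => by linarith [hK j]
    linarith
  · have hI1 : ∀ᶠ μ in nhdsWithin (0 : ℝ) (Set.Ioi 0), μ ∈ Set.Ioo 0 (min 1 (μ0 / 2)) :=
      Ioo_mem_nhdsGT (by positivity)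
    have hall := (Filter.eventually_all.2 hev).and hI1
    obtain ⟨e, he, hee⟩ := (mem_nhdsGT_iff_exists_Ioo_subset).1 hall
    have he0 : (0 : ℝ) < e := he
    refine ⟨min e (μ0 / 2), ⟨by positivity, (min_le_right _ _).trans_lt (by linarith)⟩, ?_⟩
    intro μ hμ
    obtain ⟨h1, h2⟩ := hee ⟨hμ.1, hμ.2.trans_le (min_le_left _ _)⟩
    have hμ1 : μ ≤ 1 := (h2.2.trans_le (min_le_left _ _)).le
    have hμ0' : 0 < μ := hμ.1
    have hKs : 0 ≤ ∑ j, (K j + 1) := Finset.sum_nonneg fun j _ => by linarith [hK j]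
    rw [pi_norm_le_iff_of_nonneg (by positivity)]
    intro j
    have h3 := h1 j
    have hmj : (0 : ℝ) < m j := by exact_mod_cast hm j
    have hmj1 : (1 : ℝ) ≤ m j := by exact_mod_cast hm j
    have hK1 : 1 ≤ K j + 1 := by linarith [hK j]
    have hle : |x μ j - xb j| ≤ (K j + 1) * μ ^ (1 / (m j : ℝ)) := by
      refine le_of_pow_le_pow_left₀ (hm j).ne' (by positivity) (h3.trans ?_)
      rw [mul_pow, ← Real.rpow_natCast (μ ^ _), ← Real.rpow_mul hμ0'.le,
        one_div_mul_cancel hmj.ne', Real.rpow_one]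
      refine mul_le_mul_of_nonneg_right ?_ hμ0'.le
      exact (by linarith : K j ≤ K j + 1).trans (le_self_pow₀ hK1 (hm j).ne')
    have hmono : μ ^ (1 / (m j : ℝ)) ≤ μ ^ (1 / (((∑ j, m j) + 1 : ℕ) : ℝ)) := by
      refine Real.rpow_le_rpow_of_exponent_ge hμ0' hμ1 ?_
      refine one_div_le_one_div_of_le hmj ?_
      have : m j ≤ ∑ j, m j := Finset.single_le_sum (f := m) (fun _ _ => Nat.zero_le _)
        (Finset.mem_univ j)
      exact_mod_cast this.trans (Nat.le_succ _)
    have hKle : K j + 1 ≤ ∑ j, (K j + 1) := Finset.single_le_sum (f := fun j => K j + 1)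
      (fun i _ => by linarith [hK i]) (Finset.mem_univ j)
    rw [Pi.sub_apply, Real.norm_eq_abs]
    refine hle.trans (mul_le_mul (by linarith) hmono (by positivity) (by positivity))
end

section
/- Let f, g_1,…,g_r ∈ ℝ[X_1,…,X_n], let μ_0 > 0, and let x : (0,μ_0) → ℝ^n be a bounded critical path: x is continuous, its image is bounded, and for every μ ∈ (0,μ_0), x(μ) satisfies g_i(x(μ)) > 0 for all i, ∇f(x(μ)) = μ·Σ_{i=1}^r ∇g_i(x(μ))/g_i(x(μ)), and x(μ) is an isolated point of the set of all such solutions. Then there exists a positive integer ρ such that the reparametrized path μ ↦ x(μ^ρ) is real-analytic at μ = 0: there exist ε > 0 and a map y : (−ε,ε) → ℝ^n, real-analytic on (−ε,ε), with y(μ) = x(μ^ρ) for all μ ∈ (0,ε). (Real-number form of the theorem that a bounded critical path of polynomial optimization admits an analytic reparametrization at μ = 0.) -/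
section PartB
open Filter Topology Polynomial
open scoped ContDiff

/-- functions analytic at zero -/
def AnZ : Subalgebra ℝ (ℝ → ℝ) where
  carrier := {f | AnalyticAt ℝ f 0}
  mul_mem' := fun ha hb => AnalyticAt.mul ha hb
  add_mem' := fun ha hb => AnalyticAt.add ha hb
  algebraMap_mem' := fun r => by
    change AnalyticAt ℝ (fun _ => r) 0
    exact analyticAt_const

/-- evaluation at t -/
def evZ (t : ℝ) : AnZ →+* ℝ := (Pi.evalRingHom (fun _ : ℝ => ℝ) t).comp AnZ.val.toRingHom

theorem evZ_apply (t : ℝ) (a : AnZ) : evZ t a = a.1 t := rfl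

theorem evZ_an (a : AnZ) : AnalyticAt ℝ (fun t => evZ t a) 0 := a.2

theorem evZ_eval₂ (p : AnZ[X]) (t y : ℝ) :
    p.eval₂ (evZ t) y = ∑ i ∈ Finset.range (p.natDegree + 1), evZ t (p.coeff i) * y ^ i := by
  rw [Polynomial.eval₂_eq_sum_range]

theorem eval₂_taylor_evZ (p : AnZ[X]) (a : AnZ) (t y : ℝ) :
    (taylor a p).eval₂ (evZ t) y = p.eval₂ (evZ t) (y + evZ t a) := by
  rw [← eval_map, map_taylor, taylor_eval, eval_map]

theorem evZ_tendsto (p : AnZ[X]) {α : Type*} {l : Filter α} {u h : α → ℝ} {c : ℝ}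
    (hu : Tendsto u l (𝓝 0)) (hh : Tendsto h l (𝓝 c)) :
    Tendsto (fun s => p.eval₂ (evZ (u s)) (h s)) l (𝓝 (p.eval₂ (evZ 0) c)) := by
  simp only [evZ_eval₂]
  refine tendsto_finsetSum _ fun i _ => ?_
  exact ((evZ_an (p.coeff i)).continuousAt.tendsto.comp hu).mul (hh.pow i)

theorem implicit_root (p : AnZ[X]) (h0 : evZ 0 (p.coeff 0) = 0) (h1 : evZ 0 (p.coeff 1) ≠ 0) :
    ∃ φ : AnZ, evZ 0 φ = 0 ∧ ∀ᶠ t in 𝓝 (0:ℝ), p.eval₂ (evZ t) (evZ t φ) = 0 := by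
  let G : ℝ × ℝ → ℝ := fun v => p.eval₂ (evZ v.1) v.2
  have hG : AnalyticAt ℝ G (0, 0) := by
    have : G = fun v => ∑ i ∈ Finset.range (p.natDegree + 1), evZ v.1 (p.coeff i) * v.2 ^ i := by
      funext v; exact evZ_eval₂ p v.1 v.2
    rw [this]
    refine Finset.analyticAt_fun_sum _ fun i _ => ?_
    refine AnalyticAt.mul ?_ (analyticAt_snd.pow i)
    exact AnalyticAt.comp (g := fun t => evZ t (p.coeff i)) (f := Prod.fst) (x := ((0:ℝ),(0:ℝ)))
      (evZ_an (p.coeff i)) analyticAt_fst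
  have hC : ContDiffAt ℝ ω G (0, 0) := hG.contDiffAt
  have hD : HasFDerivAt G (fderiv ℝ G (0,0)) (0,0) := hG.differentiableAt.hasFDerivAt
  have hpart : HasDerivAt (fun y : ℝ => G (0, y)) (evZ 0 (p.coeff 1)) 0 := by
    have := (p.map (evZ 0)).hasDerivAt 0
    have h2 : (derivative (p.map (evZ 0))).eval 0 = evZ 0 (p.coeff 1) := by
      rw [← coeff_zero_eq_eval_zero, coeff_derivative]; simp
    rw [h2] at this
    have h3 : (fun y : ℝ => G (0, y)) = fun y => (p.map (evZ 0)).eval y := by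
      funext y; exact (eval_map _ _).symm
    rw [h3]; exact this
  have hpart2 : HasDerivAt (fun y : ℝ => G (0, y)) (fderiv ℝ G (0,0) (0, 1)) 0 := by
    have hc : HasDerivAt (fun y : ℝ => ((0:ℝ), y)) ((0:ℝ), (1:ℝ)) 0 :=
      (hasDerivAt_const _ _).prodMk (hasDerivAt_id _)
    exact HasFDerivAt.comp_hasDerivAt (f := fun y : ℝ => ((0:ℝ), y)) (0:ℝ) hD hc
  have hval := hpart2.unique hpart
  have hinv : (fderiv ℝ G (0,0) ∘L .inr ℝ ℝ ℝ).IsInvertible := by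
    refine ⟨ContinuousLinearEquiv.unitsEquivAut ℝ (Units.mk0 _ h1), ?_⟩
    ext
    simp [hval]
  have hne : (ω : WithTop ℕ∞) ≠ 0 := by simp
  let ψ := hC.implicitFunction hne hinv
  have ha : AnalyticAt ℝ ψ 0 := (hC.contDiffAt_implicitFunction hne hinv).analyticAt
  refine ⟨⟨ψ, ha⟩, hC.implicitFunction_apply_self hne hinv, ?_⟩
  have := hC.eventually_apply_implicitFunction hne hinv
  have hG0 : G (0, 0) = 0 := by
    simp only [G]
    rw [← eval_map, ← coeff_zero_eq_eval_zero, coeff_map, h0]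
  rw [hG0] at this
  exact this

theorem conv_root (p : AnZ[X]) (hp : p.map (evZ 0) ≠ 0) (h : ℝ → ℝ)
    (hc : ∀ᶠ t in 𝓝[>] (0:ℝ), ContinuousAt h t) (B : ℝ) (hB : ∀ᶠ t in 𝓝[>] (0:ℝ), |h t| ≤ B)
    (hr : ∀ᶠ t in 𝓝[>] (0:ℝ), p.eval₂ (evZ t) (h t) = 0) :
    ∃ c, Tendsto h (𝓝[>] 0) (𝓝 c) ∧ p.eval₂ (evZ 0) c = 0 := by
  have hid : Tendsto (fun t : ℝ => t) (𝓝[>] 0) (𝓝 0) := tendsto_id.mono_left nhdsWithin_le_nhds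
  obtain ⟨c, hcl⟩ : ∃ c, Tendsto h (𝓝[>] 0) (𝓝 c) := by
    refine tendsto_of_no_upcrossings dense_univ ?_ ⟨B, ?_⟩ ⟨-B, ?_⟩
    · rintro a - b - hab ⟨hfa, hfb⟩
      obtain ⟨v, hv, hv0⟩ : ∃ v ∈ Set.Ioo a b, (p.map (evZ 0)).eval v ≠ 0 := by
        by_contra! hcon
        apply hp
        apply Polynomial.eq_zero_of_infinite_isRoot
        exact (Set.Ioo_infinite hab).mono hcon
      have ht := evZ_tendsto p hid (tendsto_const_nhds (x := v))
      rw [eval_map] at hv0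
      have hev := ht.eventually_ne hv0
      have hall := hev.and (hc.and hr)
      rw [eventually_nhdsWithin_iff, Metric.eventually_nhds_iff] at hall
      obtain ⟨e, he, hall⟩ := hall
      have hI : ∀ᶠ t in 𝓝[>] (0:ℝ), t ∈ Set.Ioo 0 e := Ioo_mem_nhdsGT he
      obtain ⟨s, hs1, hs2⟩ := (hfa.and_eventually hI).exists
      obtain ⟨t, ht1, ht2⟩ := (hfb.and_eventually hI).exists
      have hh : ∀ u ∈ Set.Ioo (0:ℝ) e, _ := fun u hu => hall (y := u)
        (by rw [Real.dist_eq, sub_zero, abs_of_pos hu.1]; exact hu.2) hu.1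
      have hcon : ContinuousOn h (Set.Ioo 0 e) := fun u hu => (hh u hu).2.1.continuousWithinAt
      obtain ⟨u, hu, huv⟩ := isPreconnected_Ioo.intermediate_value hs2 ht2 hcon
        ⟨(hs1.trans hv.1).le, (hv.2.trans ht1).le⟩
      have := hh u hu
      rw [huv] at this
      exact this.1 this.2.2
    · exact hB.mono fun t ht => (abs_le.1 ht).2
    · exact hB.mono fun t ht => (abs_le.1 ht).1
  refine ⟨c, hcl, ?_⟩
  have ht := evZ_tendsto p hid hcl
  refine tendsto_nhds_unique ht ?_
  exact tendsto_const_nhds.congr' (hr.mono fun t h => h.symm)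

theorem tendsto_pow_nhdsGT {q : ℕ} (hq : 0 < q) :
    Tendsto (fun s : ℝ => s ^ q) (𝓝[>] 0) (𝓝[>] 0) := by
  refine tendsto_nhdsWithin_iff.2 ⟨?_, ?_⟩
  · have : Tendsto (fun s : ℝ => s ^ q) (𝓝 0) (𝓝 (0 ^ q)) := (continuous_pow q).tendsto 0
    rw [zero_pow hq.ne'] at this
    exact this.mono_left nhdsWithin_le_nhds
  · filter_upwards [self_mem_nhdsWithin] with s hs
    exact pow_pos (Set.mem_Ioi.1 hs) q

theorem tendsto_pow_nhds0 {q : ℕ} (hq : 0 < q) :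
    Tendsto (fun s : ℝ => s ^ q) (𝓝 0) (𝓝 0) := by
  have : Tendsto (fun s : ℝ => s ^ q) (𝓝 0) (𝓝 (0 ^ q)) := (continuous_pow q).tendsto 0
  rwa [zero_pow hq.ne'] at this

theorem an_comp_pow {u : ℝ → ℝ} (hu : AnalyticAt ℝ u 0) {q : ℕ} (hq : 0 < q) :
    AnalyticAt ℝ (fun s => u (s ^ q)) 0 := by
  refine AnalyticAt.fun_comp (g := u) (f := fun s : ℝ => s ^ q) ?_ (analyticAt_id.pow q)
  simpa [zero_pow hq.ne'] using hu

theorem scaling (a : ℕ → AnZ) (m : ℕ) (ha0 : ∀ i < m, evZ 0 (a i) = 0)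
    (hne : ∃ i < m, ¬ ∀ᶠ t in 𝓝 (0:ℝ), evZ t (a i) = 0) :
    ∃ q k : ℕ, 0 < q ∧ 0 < k ∧ ∃ b : ℕ → AnZ,
      (∀ i, ∀ᶠ s in 𝓝 (0:ℝ), s ^ (k * m) * evZ s (b i) = s ^ (k * i) * evZ (s ^ q) (a i)) ∧
      evZ 0 (b m) = evZ 0 (a m) ∧ (∀ i > m, evZ 0 (b i) = 0) ∧ ∃ i < m, evZ 0 (b i) ≠ 0 := by
  classical
  let o : ℕ → ℕ∞ := fun i => analyticOrderAt (a i).1 0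
  let S := (Finset.range m).filter fun i => o i ≠ ⊤
  let w : ℕ → ℕ := fun i => (o i).toNat * (m.factorial / (m - i))
  have hS : S.Nonempty := by
    obtain ⟨i, hi, h⟩ := hne
    refine ⟨i, ?_⟩
    simp only [S, Finset.mem_filter, Finset.mem_range]
    refine ⟨hi, fun h' => h ?_⟩
    exact analyticOrderAt_eq_top.1 h'
  obtain ⟨i0, hi0, hmin⟩ := S.exists_min_image w hS
  have hi0' : i0 < m ∧ o i0 ≠ ⊤ := by simpa [S] using hi0
  have hdvd : ∀ i < m, m.factorial / (m - i) * (m - i) = m.factorial := fun i hi =>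
    Nat.div_mul_cancel (Nat.dvd_factorial (by omega) (by omega))
  have hq : 0 < m.factorial := m.factorial_pos
  have hw : ∀ i < m, w i * (m - i) = m.factorial * (o i).toNat := fun i hi => by
    simp only [w]; rw [mul_assoc, hdvd i hi, mul_comm]
  have hk : 0 < w i0 := by
    have h1 : 0 < m.factorial / (m - i0) := by
      rcases Nat.eq_zero_or_pos (m.factorial / (m - i0)) with h | h
      · have := hdvd i0 hi0'.1
        rw [h] at this; omega
      · exact h
    refine Nat.mul_pos ?_ h1
    rcases Nat.eq_zero_or_pos (o i0).toNat with h | h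
    · exfalso
      rw [ENat.toNat_eq_zero] at h
      rcases h with h | h
      · exact (AnalyticAt.analyticOrderAt_eq_zero (a i0).2).1 h (ha0 i0 hi0'.1)
      · exact hi0'.2 h
    · exact h
  refine ⟨m.factorial, w i0, hq, hk, ?_⟩
  have key : ∀ i, ∃ b : AnZ,
      (∀ᶠ s in 𝓝 (0:ℝ), s ^ (w i0 * m) * evZ s b = s ^ (w i0 * i) * evZ (s ^ m.factorial) (a i)) ∧
      (i = m → evZ 0 b = evZ 0 (a m)) ∧ (i > m → evZ 0 b = 0) ∧ (i = i0 → evZ 0 b ≠ 0) := by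
    intro i
    rcases le_or_gt m i with him | him
    · refine ⟨⟨fun s => s ^ (w i0 * (i - m)) * (a i).1 (s ^ m.factorial),
        (analyticAt_id.pow _).mul (an_comp_pow (a i).2 hq)⟩, ?_, ?_, ?_, ?_⟩
      · refine Eventually.of_forall fun s => ?_
        simp only [evZ_apply]
        rw [← mul_assoc, ← pow_add, ← mul_add, Nat.add_sub_cancel' him]
      · rintro rfl
        simp [evZ_apply, zero_pow hq.ne']
      · intro h
        have : w i0 * (i - m) ≠ 0 := (Nat.mul_pos hk (by omega)).ne'
        simp [evZ_apply, zero_pow this]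
      · intro h; omega
    · by_cases hoi : o i = ⊤
      · refine ⟨0, ?_, by omega, by omega, ?_⟩
        · have := (tendsto_pow_nhds0 hq).eventually (analyticOrderAt_eq_top.1 hoi)
          filter_upwards [this] with s hs
          simp [evZ_apply, hs]
        · rintro rfl; exact absurd hoi hi0'.2
      · obtain ⟨u, hu, hu0, hue⟩ := ((a i).2.analyticOrderAt_ne_top).1 hoi
        have hle : w i0 * (m - i) ≤ m.factorial * (o i).toNat := by
          rw [← hw i him]
          exact Nat.mul_le_mul_right _ (hmin i (by simp [S, him, hoi]))
        refine ⟨⟨fun s => s ^ (m.factorial * (o i).toNat - w i0 * (m - i)) * u (s ^ m.factorial),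
          (analyticAt_id.pow _).mul (an_comp_pow hu hq)⟩, ?_, by omega, by omega, ?_⟩
        · have := (tendsto_pow_nhds0 hq).eventually hue
          filter_upwards [this] with s hs
          simp only [evZ_apply]
          rw [hs]
          have e1 : w i0 * m = w i0 * i + w i0 * (m - i) := by
            rw [← mul_add, Nat.add_sub_cancel' him.le]
          have e2 : analyticOrderNatAt (a i).1 0 = (o i).toNat := rfl
          rw [sub_zero, smul_eq_mul, ← pow_mul, e2, e1, pow_add, mul_assoc, ← mul_assoc (s ^ (w i0 * (m-i))),
            ← pow_add, Nat.add_sub_cancel' hle]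
        · rintro rfl
          have : m.factorial * (o i).toNat - w i * (m - i) = 0 := by rw [hw i him]; simp
          simp only [evZ_apply, this]
          simpa [zero_pow hq.ne'] using hu0
  choose b hb1 hb2 hb3 hb4 using key
  exact ⟨b, hb1, hb2 m rfl, fun i hi => hb3 i hi, i0, hi0'.1, hb4 i0 rfl⟩

theorem split_eval (p : AnZ[X]) (m : ℕ) (h : ℝ → ℝ) (hh : Tendsto h (𝓝[>] 0) (𝓝 0)) :
    ∃ R : ℝ → ℝ, Tendsto R (𝓝[>] 0) (𝓝 (evZ 0 (p.coeff m))) ∧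
      ∀ t, p.eval₂ (evZ t) (h t) =
        ∑ i ∈ Finset.range m, evZ t (p.coeff i) * h t ^ i + h t ^ m * R t := by
  refine ⟨fun t => ∑ x ∈ Finset.range (p.natDegree + 1), evZ t (p.coeff (m + x)) * h t ^ x, ?_, ?_⟩
  · have : evZ 0 (p.coeff m) =
        ∑ x ∈ Finset.range (p.natDegree + 1), evZ 0 (p.coeff (m + x)) * 0 ^ x := by
      rw [Finset.sum_eq_single 0]
      · simp
      · intro b _ hb; simp [hb]
      · simp
    rw [this]
    refine tendsto_finsetSum _ fun i _ => ?_
    exact ((evZ_an (p.coeff (m+i))).continuousAt.tendsto.mono_left nhdsWithin_le_nhds).mul (hh.pow i)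
  · intro t
    rw [eval₂_eq_sum_range' _ (n := m + (p.natDegree + 1)) (by omega), Finset.sum_range_add,
      Finset.mul_sum]
    congr 1
    refine Finset.sum_congr rfl fun x _ => ?_
    rw [pow_add]; ring

theorem taylor_mult (Q : ℝ[X]) (m : ℕ) (hm : 0 < m) (h1 : Q.coeff (m - 1) = 0)
    (h2 : Q.coeff m ≠ 0) (h3 : ∀ i > m, Q.coeff i = 0) (h4 : ∃ i < m, Q.coeff i ≠ 0) (c : ℝ) :
    ∃ i < m, (taylor c Q).coeff i ≠ 0 := by
  by_contra! hcon
  have hh := hcon (m - 1) (by omega)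
  have hd : hasseDeriv (m - 1) Q = C (m * Q.coeff m) * X := by
    ext n
    rw [hasseDeriv_coeff, coeff_C_mul, coeff_X]
    rcases n with _ | _ | n
    · simp [h1]
    · have e : 0 + 1 + (m - 1) = m := by omega
      have e2 : m.choose (m - 1) = m := by
        obtain ⟨k, rfl⟩ : ∃ k, m = k + 1 := ⟨m - 1, by omega⟩
        simp
      simp [e, e2]
    · rw [h3 _ (by omega)]; simp
  rw [taylor_coeff, hd, eval_mul, eval_C, eval_X] at hh
  have hc : c = 0 := by
    have : (m:ℝ) ≠ 0 := by exact_mod_cast hm.ne'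
    simpa [this, h2] using hh
  obtain ⟨i, hi, hi2⟩ := h4
  apply hi2
  have := hcon i hi
  rwa [hc, taylor_zero] at this

theorem root_bound (m : ℕ) (b : ℕ → ℝ) (z R M r : ℝ) (hr : 0 < r) (hR : r ≤ |R|)
    (hb : ∀ i < m, |b i| ≤ M) (hM : 0 ≤ M)
    (h : ∑ i ∈ Finset.range m, b i * z ^ i + z ^ m * R = 0) : |z| ≤ 1 + m * M / r := by
  rcases le_or_gt |z| 1 with h1 | h1
  · have : 0 ≤ m * M / r := by positivity
    linarith
  rcases Nat.eq_zero_or_pos m with rfl | hm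
  · simp at h
    rw [h] at hR; simp at hR; linarith
  have e1 : |z| ^ m * |R| ≤ m * (M * |z| ^ (m - 1)) := by
    have : z ^ m * R = - ∑ i ∈ Finset.range m, b i * z ^ i := by linarith
    rw [← abs_pow, ← abs_mul, this, abs_neg]
    refine (Finset.abs_sum_le_sum_abs _ _).trans ?_
    have : ∑ i ∈ Finset.range m, |b i * z ^ i| ≤ ∑ i ∈ Finset.range m, M * |z| ^ (m - 1) := by
      refine Finset.sum_le_sum fun i hi => ?_
      have hi := Finset.mem_range.1 hi
      rw [abs_mul, abs_pow]
      exact mul_le_mul (hb i hi) (pow_le_pow_right₀ h1.le (by omega)) (by positivity) hM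
    refine this.trans ?_
    simp
  have e2 : |z| ^ m = |z| ^ (m - 1) * |z| := by rw [← pow_succ]; congr 1; omega
  have hp : 0 < |z| ^ (m - 1) := by positivity
  have e3 : |z| * r ≤ m * M := by
    have h5 : |z| ^ (m-1) * (|z| * r) ≤ |z| ^ (m - 1) * (m * M) := by
      calc |z| ^ (m-1) * (|z| * r) = |z| ^ m * r := by rw [e2]; ring
        _ ≤ |z| ^ m * |R| := by gcongr
        _ ≤ _ := e1
        _ = _ := by ring
    exact le_of_mul_le_mul_left h5 hp
  have : |z| ≤ m * M / r := by rw [le_div_iff₀ hr]; exact e3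
  linarith

theorem puiseux_aux (m : ℕ) : ∀ (p : AnZ[X]) (h : ℝ → ℝ),
    (∀ᶠ t in 𝓝[>] (0:ℝ), ContinuousAt h t) → Tendsto h (𝓝[>] 0) (𝓝 0) →
    (∀ᶠ t in 𝓝[>] (0:ℝ), p.eval₂ (evZ t) (h t) = 0) →
    (∀ i < m, evZ 0 (p.coeff i) = 0) → evZ 0 (p.coeff m) ≠ 0 →
    ∃ ρ : ℕ, 0 < ρ ∧ ∃ H : ℝ → ℝ, AnalyticAt ℝ H 0 ∧ ∀ᶠ t in 𝓝[>] (0:ℝ), h (t ^ ρ) = H t := by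
  induction m using Nat.strong_induction_on with
  | _ m IH =>
  intro p h hcont hlim hroot hlow hm0
  have hid : Tendsto (fun t : ℝ => t) (𝓝[>] 0) (𝓝 0) := tendsto_id.mono_left nhdsWithin_le_nhds
  rcases Nat.eq_zero_or_pos m with rfl | hm
  · exfalso
    have ht := evZ_tendsto p hid hlim
    have h0 : p.eval₂ (evZ 0) 0 = 0 := by
      refine tendsto_nhds_unique ht ?_
      exact tendsto_const_nhds.congr' (hroot.mono fun t h => h.symm)
    apply hm0
    rw [← eval_map, ← coeff_zero_eq_eval_zero, coeff_map] at h0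
    exact h0
  -- Tschirnhaus
  obtain ⟨φ, hφ0, hφ⟩ := implicit_root (hasseDeriv (m - 1) p)
    (by rw [hasseDeriv_coeff, map_mul, zero_add, hlow _ (by omega), mul_zero])
    (by
      have e : 1 + (m - 1) = m := by omega
      rw [hasseDeriv_coeff, map_mul, e, map_natCast]
      refine mul_ne_zero ?_ hm0
      exact_mod_cast (Nat.choose_pos (by omega)).ne')
  let p1 := taylor φ p
  let h1 : ℝ → ℝ := fun t => h t - evZ t φ
  have hp10 : ∀ i, evZ 0 (p1.coeff i) = evZ 0 (p.coeff i) := fun i => by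
    rw [← coeff_map, map_taylor, hφ0, taylor_zero, coeff_map]
  have hp1m : ∀ᶠ t in 𝓝 (0:ℝ), evZ t (p1.coeff (m - 1)) = 0 := by
    filter_upwards [hφ] with t ht
    simp only [p1]
    rw [taylor_coeff, ← ht, ← eval₂_hom]
  have hroot1 : ∀ᶠ t in 𝓝[>] (0:ℝ), p1.eval₂ (evZ t) (h1 t) = 0 := by
    filter_upwards [hroot] with t ht
    simp only [p1, h1]
    rw [eval₂_taylor_evZ, sub_add_cancel, ht]
  have hφlim : Tendsto (fun t => evZ t φ) (𝓝[>] 0) (𝓝 0) := by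
    have := (evZ_an φ).continuousAt.tendsto
    rw [hφ0] at this
    exact this.mono_left nhdsWithin_le_nhds
  have hlim1 : Tendsto h1 (𝓝[>] 0) (𝓝 0) := by
    simpa using hlim.sub hφlim
  have hcont1 : ∀ᶠ t in 𝓝[>] (0:ℝ), ContinuousAt h1 t := by
    filter_upwards [hcont, nhdsWithin_le_nhds (evZ_an φ).eventually_analyticAt] with t ht1 ht2
    exact ht1.sub ht2.continuousAt
  suffices hs : ∃ ρ : ℕ, 0 < ρ ∧ ∃ H : ℝ → ℝ, AnalyticAt ℝ H 0 ∧
      ∀ᶠ t in 𝓝[>] (0:ℝ), h1 (t ^ ρ) = H t by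
    obtain ⟨ρ, hρ, H, hH, he⟩ := hs
    refine ⟨ρ, hρ, fun t => H t + evZ (t ^ ρ) φ, hH.add (an_comp_pow (evZ_an φ) hρ), ?_⟩
    filter_upwards [he] with t ht
    rw [← ht]; simp [h1]
  have hlow1 : ∀ i < m, evZ 0 (p1.coeff i) = 0 := fun i hi => by rw [hp10, hlow i hi]
  have hm1 : evZ 0 (p1.coeff m) ≠ 0 := by rwa [hp10]
  clear_value h1 p1
  clear hroot hlim hcont hlow hm0 hp10
  obtain ⟨R, hR, hsplit⟩ := split_eval p1 m h1 hlim1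
  by_cases hz : ∃ i < m, ¬ ∀ᶠ t in 𝓝 (0:ℝ), evZ t (p1.coeff i) = 0
  swap
  · push Not at hz
    refine ⟨1, one_pos, fun _ => 0, analyticAt_const, ?_⟩
    have hall : ∀ᶠ t in 𝓝 (0:ℝ), ∀ i ∈ Finset.range m, evZ t (p1.coeff i) = 0 :=
      (Finset.eventually_all _).2 fun i hi => hz i (Finset.mem_range.1 hi)
    filter_upwards [nhdsWithin_le_nhds hall, hR.eventually_ne hm1, hroot1] with t h1t h2t h3t
    rw [hsplit, Finset.sum_eq_zero (fun i hi => by rw [h1t i hi, zero_mul]), zero_add] at h3t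
    rw [pow_one]
    rcases mul_eq_zero.1 h3t with h | h
    · exact pow_eq_zero_iff hm.ne' |>.1 h
    · exact absurd h h2t
  obtain ⟨q, k, hq, hk, b, hb, hbm, hbgt, i0, hi0, hbi0⟩ := scaling p1.coeff m hlow1 hz
  let z : ℝ → ℝ := fun s => h1 (s ^ q) / s ^ k
  have hzs : ∀ s : ℝ, 0 < s → h1 (s ^ q) = s ^ k * z s := fun s hs => by
    have := (pow_pos hs k).ne'
    simp only [z]; field_simp
  have hpq := tendsto_pow_nhdsGT hq
  have hzc : ∀ᶠ s in 𝓝[>] (0:ℝ), ContinuousAt z s := by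
    filter_upwards [hpq.eventually hcont1, self_mem_nhdsWithin] with s hs1 hs2
    have hs2 : 0 < s := hs2
    refine ContinuousAt.div ?_ (continuous_pow k).continuousAt (pow_pos hs2 k).ne'
    exact ContinuousAt.comp (g := h1) (f := fun s : ℝ => s ^ q) hs1 (continuous_pow q).continuousAt
  let N := p1.natDegree + 1
  have hmN : m < N := by
    have : m ≤ p1.natDegree := le_natDegree_of_ne_zero (fun h => hm1 (by rw [h, map_zero]))
    simp only [N]; omega
  let Q : AnZ[X] := ∑ i ∈ Finset.range N, C (b i) * X ^ i
  have hQc : ∀ i, Q.coeff i = if i < N then b i else 0 := fun i => by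
    simp [Q, coeff_C_mul, coeff_X_pow]
  have hQe : ∀ s y, Q.eval₂ (evZ s) y = ∑ i ∈ Finset.range N, evZ s (b i) * y ^ i := fun s y => by
    simp [Q, eval₂_finsetSum]
  have hball : ∀ᶠ s in 𝓝[>] (0:ℝ), ∀ i ∈ Finset.range N,
      s ^ (k * m) * evZ s (b i) = s ^ (k * i) * evZ (s ^ q) (p1.coeff i) :=
    nhdsWithin_le_nhds ((Finset.eventually_all _).2 fun i _ => hb i)
  have hQroot : ∀ᶠ s in 𝓝[>] (0:ℝ), Q.eval₂ (evZ s) (z s) = 0 := by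
    filter_upwards [hball, hpq.eventually hroot1, self_mem_nhdsWithin] with s hs1 hs2 hs3
    have hs3 : 0 < s := hs3
    have hp : s ^ (k * m) ≠ 0 := (pow_pos hs3 _).ne'
    refine (mul_eq_zero.1 ?_).resolve_left hp
    rw [← hs2, hQe, evZ_eval₂, Finset.mul_sum]
    refine Finset.sum_congr rfl fun i hi => ?_
    rw [← mul_assoc, hs1 i hi, hzs s hs3, mul_pow, ← pow_mul]; ring
  -- boundedness
  have hbd : ∃ M : ℝ, 0 ≤ M ∧ ∀ᶠ s in 𝓝[>] (0:ℝ), ∀ i < m, |evZ s (b i)| ≤ M := by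
    refine ⟨∑ i ∈ Finset.range m, (|evZ 0 (b i)| + 1), by positivity, ?_⟩
    have : ∀ᶠ s in 𝓝 (0:ℝ), ∀ i ∈ Finset.range m, |evZ s (b i)| ≤ |evZ 0 (b i)| + 1 := by
      refine (Finset.eventually_all _).2 fun i _ => ?_
      have := (evZ_an (b i)).continuousAt.abs.tendsto
      exact (this.eventually_lt_const (lt_add_one _)).mono fun s hs => hs.le
    refine nhdsWithin_le_nhds (this.mono fun s hs i hi => (hs i (Finset.mem_range.2 hi)).trans ?_)
    exact Finset.single_le_sum (f := fun i => |evZ 0 (b i)| + 1)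
      (fun i _ => by positivity) (Finset.mem_range.2 hi)
  obtain ⟨M, hM0, hM⟩ := hbd
  have hRr : ∀ᶠ t in 𝓝[>] (0:ℝ), |evZ 0 (p1.coeff m)| / 2 ≤ |R t| := by
    have := hR.abs
    have hpos : 0 < |evZ 0 (p1.coeff m)| := abs_pos.2 hm1
    exact (this.eventually_const_lt (half_lt_self hpos)).mono fun s hs => hs.le
  have hzb : ∀ᶠ s in 𝓝[>] (0:ℝ), |z s| ≤ 1 + m * M / (|evZ 0 (p1.coeff m)| / 2) := by
    filter_upwards [hball, hpq.eventually hroot1, self_mem_nhdsWithin, hM, hpq.eventually hRr]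
      with s hs1 hs2 hs3 hs4 hs5
    have hs3 : 0 < s := hs3
    refine root_bound m (fun i => evZ s (b i)) (z s) (R (s ^ q)) M _ (half_pos (abs_pos.2 hm1))
      hs5 hs4 hM0 ?_
    have hp : s ^ (k * m) ≠ 0 := (pow_pos hs3 _).ne'
    refine (mul_eq_zero.1 ?_).resolve_left hp
    rw [← hs2, hsplit, mul_add, Finset.mul_sum]
    congr 1
    · refine Finset.sum_congr rfl fun i hi => ?_
      rw [← mul_assoc, hs1 i (Finset.mem_range.2 ((Finset.mem_range.1 hi).trans hmN)),
        hzs s hs3, mul_pow, ← pow_mul]; ring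
    · rw [hzs s hs3, mul_pow, ← pow_mul]; ring
  have hbm1 : evZ 0 (b (m - 1)) = 0 := by
    have h0 : ∀ᶠ s in 𝓝[>] (0:ℝ), evZ s (b (m - 1)) = 0 := by
      filter_upwards [hball, self_mem_nhdsWithin,
        hpq.eventually (nhdsWithin_le_nhds hp1m)] with s hs1 hs2 hs3
      have hs2 : 0 < s := hs2
      have := hs1 (m - 1) (Finset.mem_range.2 (by omega))
      rw [hs3, mul_zero] at this
      exact (mul_eq_zero.1 this).resolve_left (pow_pos hs2 _).ne'
    have h1 := (evZ_an (b (m - 1))).continuousAt.tendsto.mono_left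
      (nhdsWithin_le_nhds (s := Set.Ioi 0))
    exact tendsto_nhds_unique h1 (tendsto_const_nhds.congr' (h0.mono fun t h => h.symm))
  have hQ0c : ∀ i, (Q.map (evZ 0)).coeff i = if i < N then evZ 0 (b i) else 0 := fun i => by
    rw [coeff_map, hQc]; split_ifs <;> simp
  have hQ0m : (Q.map (evZ 0)).coeff m ≠ 0 := by
    rw [hQ0c, if_pos hmN, hbm]; exact hm1
  obtain ⟨c, hcl, -⟩ := conv_root Q (fun h => hQ0m (by rw [h, coeff_zero])) z hzc _ hzb hQroot
  have hex := taylor_mult (Q.map (evZ 0)) m hm (by rw [hQ0c, if_pos (by omega), hbm1]) hQ0m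
    (fun i hi => by rw [hQ0c]; split_ifs; exacts [hbgt i hi, rfl])
    ⟨i0, hi0, by rw [hQ0c, if_pos (by omega)]; exact hbi0⟩ c
  classical
  let cc : AnZ := algebraMap ℝ AnZ c
  have hcc : ∀ t, evZ t cc = c := fun t => rfl
  have hex2 : ∃ i, evZ 0 ((taylor cc Q).coeff i) ≠ 0 := by
    obtain ⟨i, _, hi⟩ := hex
    refine ⟨i, ?_⟩
    rwa [← coeff_map, map_taylor, hcc]
  have hfm : Nat.find hex2 < m := by
    obtain ⟨i, him, hi⟩ := hex
    refine lt_of_le_of_lt (Nat.find_min' hex2 ?_) him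
    rwa [← coeff_map, map_taylor, hcc]
  obtain ⟨ρ, hρ, H, hH, he⟩ := IH (Nat.find hex2) hfm (taylor cc Q) (fun s => z s - c)
    (hzc.mono fun s hs => hs.sub continuousAt_const)
    (by simpa using hcl.sub (tendsto_const_nhds (x := c)))
    (hQroot.mono fun s hs => by rw [eval₂_taylor_evZ, hcc, sub_add_cancel, hs])
    (fun i hi => by simpa using Nat.find_min hex2 hi) (Nat.find_spec hex2)
  refine ⟨ρ * q, Nat.mul_pos hρ hq, fun s => (s ^ ρ) ^ k * (H s + c),
    ((analyticAt_id.pow ρ).pow k).mul (hH.add analyticAt_const), ?_⟩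
  filter_upwards [he, self_mem_nhdsWithin] with s hs1 hs2
  have hs2 : 0 < s := hs2
  rw [pow_mul, hzs _ (pow_pos hs2 ρ), ← hs1]; ring

theorem puiseux (P : ℝ[X][X]) (hP : P ≠ 0) (h : ℝ → ℝ)
    (hcont : ∀ᶠ t in 𝓝[>] (0:ℝ), ContinuousAt h t) (B : ℝ)
    (hB : ∀ᶠ t in 𝓝[>] (0:ℝ), |h t| ≤ B)
    (hr : ∀ᶠ t in 𝓝[>] (0:ℝ), P.eval₂ (evalRingHom t) (h t) = 0) :
    ∃ ρ : ℕ, 0 < ρ ∧ ∃ H : ℝ → ℝ, AnalyticAt ℝ H 0 ∧ ∀ᶠ t in 𝓝[>] (0:ℝ), h (t ^ ρ) = H t := by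
  have hfin : FiniteMultiplicity (C X : ℝ[X][X]) P := by
    refine FiniteMultiplicity.of_not_isUnit ?_ hP
    rw [isUnit_C]; exact not_isUnit_X
  obtain ⟨P', hPP', hnd⟩ := hfin.exists_eq_pow_mul_and_not_dvd
  let ι : ℝ[X] →+* AnZ := (aeval (⟨id, analyticAt_id⟩ : AnZ)).toRingHom
  have hι : ∀ t, (evZ t).comp ι = evalRingHom t := fun t => by
    ext r
    · simp [ι, evZ_apply]
    · simp [ι, evZ_apply]
  have hr' : ∀ᶠ t in 𝓝[>] (0:ℝ), (P'.map ι).eval₂ (evZ t) (h t) = 0 := by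
    filter_upwards [hr, self_mem_nhdsWithin] with t ht ht0
    have ht0 : 0 < t := ht0
    rw [eval₂_map, hι]
    rw [hPP', eval₂_mul, eval₂_pow, eval₂_C, coe_evalRingHom, eval_X] at ht
    exact (mul_eq_zero.1 ht).resolve_left (pow_pos ht0 _).ne'
  have hne : (P'.map ι).map (evZ 0) ≠ 0 := by
    intro h0
    apply hnd
    rw [C_dvd_iff_dvd_coeff]
    intro i
    rw [X_dvd_iff, coeff_zero_eq_eval_zero]
    rw [Polynomial.map_map, hι] at h0
    have := congrArg (fun q => coeff q i) h0
    simpa using this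
  obtain ⟨c, hcl, -⟩ := conv_root _ hne h hcont B hB hr'
  classical
  let cc : AnZ := algebraMap ℝ AnZ c
  have hcc : ∀ t, evZ t cc = c := fun t => rfl
  have hex2 : ∃ i, evZ 0 ((taylor cc (P'.map ι)).coeff i) ≠ 0 := by
    by_contra! hcon
    apply hne
    rw [← taylor_eq_zero c]
    ext i
    have := hcon i
    rw [← coeff_map, map_taylor, hcc] at this
    rw [this, coeff_zero]
  obtain ⟨ρ, hρ, H, hH, he⟩ := puiseux_aux (Nat.find hex2) (taylor cc (P'.map ι)) (fun s => h s - c)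
    (hcont.mono fun s hs => hs.sub continuousAt_const)
    (by simpa using hcl.sub (tendsto_const_nhds (x := c)))
    (hr'.mono fun s hs => by rw [eval₂_taylor_evZ, hcc, sub_add_cancel, hs])
    (fun i hi => by simpa using Nat.find_min hex2 hi) (Nat.find_spec hex2)
  refine ⟨ρ, hρ, fun s => H s + c, hH.add analyticAt_const, ?_⟩
  filter_upwards [he] with s hs
  rw [← hs]; ring

end PartB

section PartA
open Filter Topology

theorem integral_of_pow {R S : Type*} [CommRing R] [CommRing S] [Algebra R S] (n N : ℕ)
    (y : Fin n → S) (G : Fin n → MvPolynomial (Fin n) R) (hG : ∀ i, (G i).totalDegree < N)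
    (h : ∀ i, y i ^ N = MvPolynomial.aeval y (G i)) (j : Fin n) : IsIntegral R (y j) := by
  classical
  let M : Submodule R S :=
    Submodule.span R (Set.range fun α : Fin n → Fin N => ∏ i, y i ^ (α i : ℕ))
  have key : ∀ d : ℕ, ∀ α : Fin n → ℕ, ∑ i, α i = d → ∏ i, y i ^ α i ∈ M := by
    intro d
    induction d using Nat.strong_induction_on with
    | _ d IH =>
    intro α hα
    by_cases hlt : ∀ i, α i < N
    · exact Submodule.subset_span ⟨fun i => ⟨α i, hlt i⟩, rfl⟩
    · push Not at hlt
      obtain ⟨i, hi⟩ := hlt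
      let β : Fin n → ℕ := Function.update α i (α i - N)
      have hsplit : ∏ l, y l ^ α l = (∏ l, y l ^ β l) * y i ^ N := by
        rw [← Finset.mul_prod_erase _ _ (Finset.mem_univ i),
          ← Finset.mul_prod_erase _ (fun l => y l ^ β l) (Finset.mem_univ i)]
        have e1 : ∏ x ∈ Finset.univ.erase i, y x ^ β x = ∏ x ∈ Finset.univ.erase i, y x ^ α x :=
          Finset.prod_congr rfl fun x hx => by
            simp [β, Function.update_of_ne (Finset.ne_of_mem_erase hx)]
        have e2 : y i ^ α i = y i ^ β i * y i ^ N := by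
          rw [← pow_add]; simp [β, hi]
        rw [e1, e2]; ring
      have hsum : ∑ l, β l + N = d := by
        rw [← hα, ← Finset.add_sum_erase _ _ (Finset.mem_univ i),
          ← Finset.add_sum_erase _ α (Finset.mem_univ i)]
        have e1 : ∑ x ∈ Finset.univ.erase i, β x = ∑ x ∈ Finset.univ.erase i, α x :=
          Finset.sum_congr rfl fun x hx => by
            simp [β, Function.update_of_ne (Finset.ne_of_mem_erase hx)]
        rw [e1]
        simp only [β, Function.update_self]; omega
      rw [hsplit, h i, MvPolynomial.aeval_def, MvPolynomial.eval₂_eq', Finset.mul_sum]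
      refine Submodule.sum_mem _ fun γ hγ => ?_
      have e : (∏ l, y l ^ β l) * (algebraMap R S (MvPolynomial.coeff γ (G i)) * ∏ l, y l ^ γ l)
          = MvPolynomial.coeff γ (G i) • ∏ l, y l ^ (β l + γ l) := by
        rw [Algebra.smul_def]
        simp only [pow_add, Finset.prod_mul_distrib]; ring
      rw [e]
      refine Submodule.smul_mem _ _ (IH (∑ l, (β l + γ l)) ?_ _ rfl)
      have h1 := MvPolynomial.le_totalDegree hγ
      rw [Finsupp.sum_fintype _ _ (fun _ => rfl)] at h1
      have h2 := hG i
      rw [Finset.sum_add_distrib]; omega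
  have hM : Subalgebra.toSubmodule (MvPolynomial.aeval (R := R) y).range = M := by
    apply le_antisymm
    · rintro _ ⟨p, rfl⟩
      change MvPolynomial.aeval y p ∈ M
      rw [MvPolynomial.aeval_def, MvPolynomial.eval₂_eq']
      refine Submodule.sum_mem _ fun γ _ => ?_
      rw [← Algebra.smul_def]
      exact Submodule.smul_mem _ _ (key _ _ rfl)
    · refine Submodule.span_le.2 ?_
      rintro _ ⟨α, rfl⟩
      refine ⟨∏ i, MvPolynomial.X i ^ (α i : ℕ), ?_⟩
      simp
  refine IsIntegral.of_mem_of_fg (MvPolynomial.aeval (R := R) y).range ?_ (y j) ⟨MvPolynomial.X j, by simp⟩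
  rw [hM]
  exact Submodule.fg_span (Set.finite_range _)

theorem hasDerivAt_pderiv {n : ℕ} (p : MvPolynomial (Fin n) ℝ) (y : Fin n → ℝ) (i : Fin n) :
    HasDerivAt (fun t => MvPolynomial.eval (Function.update y i t) p)
      (MvPolynomial.eval y (MvPolynomial.pderiv i p)) (y i) := by
  induction p using MvPolynomial.induction_on with
  | C a => simpa using hasDerivAt_const (y i) a
  | add p q hp hq => simpa using hp.fun_add hq
  | mul_X p j hp =>
    have hX : HasDerivAt (fun t => Function.update y i t j) (if i = j then 1 else 0) (y i) := by
      split_ifs with hij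
      · subst hij; simpa using hasDerivAt_id' (y i)
      · have : (fun t => Function.update y i t j) = fun _ => y j := by
          funext t; rw [Function.update_of_ne (Ne.symm hij)]
        rw [this]; exact hasDerivAt_const _ _
    have := hp.mul hX
    simp only [Function.update_eq_self] at this
    simp only [MvPolynomial.eval_mul, MvPolynomial.eval_X, Derivation.leibniz, smul_eq_mul,
      MvPolynomial.pderiv_X, MvPolynomial.eval_add, Pi.single_apply]
    refine this.congr_deriv ?_
    by_cases hij : i = j
    · subst hij; simp; ring
    · simp [hij, Ne.symm hij]; ring

theorem crit_seq {n : ℕ} (F : MvPolynomial (Fin n) ℝ) (T : ℕ) (x : Fin n → ℝ) (δ : ℝ) (hδ : 0 < δ)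
    (h0 : MvPolynomial.eval x F = 0) (hnn : ∀ y, 0 ≤ MvPolynomial.eval y F)
    (hiso : ∀ y, dist y x ≤ δ → MvPolynomial.eval y F = 0 → y = x) :
    ∃ Y : ℕ → Fin n → ℝ, Tendsto Y atTop (𝓝 x) ∧ ∀ᶠ k in atTop, ∀ i,
      Y k i ^ (2 * T + 1) + ((k : ℝ) + 1) * MvPolynomial.eval (Y k) (MvPolynomial.pderiv i F) = 0 := by
  classical
  let V : (Fin n → ℝ) → ℝ := fun y => ∑ i, y i ^ (2 * T + 2) / (2 * T + 2)
  have hV0 : ∀ y, 0 ≤ V y := fun y => Finset.sum_nonneg fun i _ => by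
    have : Even (2 * T + 2) := ⟨T + 1, by ring⟩
    have := this.pow_nonneg (y i)
    positivity
  have hVc : Continuous V := by simp only [V]; fun_prop
  have hFc : Continuous fun y => MvPolynomial.eval y F := MvPolynomial.continuous_eval F
  let Φ : ℕ → (Fin n → ℝ) → ℝ := fun k y => V y + ((k:ℝ) + 1) * MvPolynomial.eval y F
  have hcomp : IsCompact (Metric.closedBall x δ) := isCompact_closedBall x δ
  have hex : ∀ k, ∃ y ∈ Metric.closedBall x δ, IsMinOn (Φ k) (Metric.closedBall x δ) y := fun k =>
    hcomp.exists_isMinOn ⟨x, Metric.mem_closedBall_self hδ.le⟩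
      (hVc.add (continuous_const.mul hFc)).continuousOn
  choose Y hYm hYmin using hex
  have hFb : ∀ k : ℕ, MvPolynomial.eval (Y k) F ≤ V x / ((k:ℝ) + 1) := fun k => by
    have h1 : Φ k (Y k) ≤ Φ k x := hYmin k (Metric.mem_closedBall_self hδ.le)
    simp only [Φ, h0, mul_zero, add_zero] at h1
    have h2 := hV0 (Y k)
    have : (0:ℝ) < (k:ℝ) + 1 := by positivity
    rw [le_div_iff₀ this]; linarith
  have hlim : Tendsto (fun k : ℕ => V x / ((k:ℝ) + 1)) atTop (𝓝 0) := by
    have := (tendsto_one_div_add_atTop_nhds_zero_nat (𝕜 := ℝ)).const_mul (V x)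
    simpa [div_eq_mul_inv] using this
  have hYt : Tendsto Y atTop (𝓝 x) := by
    refine hcomp.tendsto_nhds_of_unique_mapClusterPt (Eventually.of_forall hYm) ?_
    intro z hz hcl
    refine hiso z hz ?_
    by_contra hne
    have hpos : 0 < MvPolynomial.eval z F := lt_of_le_of_ne (hnn z) (Ne.symm hne)
    have hnb : {y | MvPolynomial.eval z F / 2 < MvPolynomial.eval y F} ∈ 𝓝 z :=
      (isOpen_lt continuous_const hFc).mem_nhds (half_lt_self hpos)
    have hfr := hcl.frequently hnb
    have hev := hlim.eventually_lt_const (half_pos hpos)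
    obtain ⟨k, hk1, hk2⟩ := (hfr.and_eventually hev).exists
    have := hFb k
    have hk1 : MvPolynomial.eval z F / 2 < MvPolynomial.eval (Y k) F := hk1
    linarith
  refine ⟨Y, hYt, ?_⟩
  filter_upwards [hYt.eventually (Metric.ball_mem_nhds x hδ)] with k hk i
  have hloc : IsLocalMin (Φ k) (Y k) :=
    (hYmin k).isLocalMin (mem_of_superset (Metric.isOpen_ball.mem_nhds hk) Metric.ball_subset_closedBall)
  have hloc2 : IsLocalMin (fun t => Φ k (Function.update (Y k) i t)) (Y k i) := by
    have hc : ContinuousAt (fun t : ℝ => Function.update (Y k) i t) (Y k i) := by fun_prop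
    have : IsLocalMin (Φ k) ((fun t : ℝ => Function.update (Y k) i t) (Y k i)) := by
      simpa using hloc
    exact hc.eventually this
  have hdV : HasDerivAt (fun t => V (Function.update (Y k) i t)) (Y k i ^ (2 * T + 1)) (Y k i) := by
    have e : ∀ l, HasDerivAt (fun t => Function.update (Y k) i t l ^ (2 * T + 2) / (2 * T + 2 : ℝ))
        (if l = i then Y k i ^ (2 * T + 1) else 0) (Y k i) := by
      intro l
      split_ifs with hl
      · subst hl
        have h1 := (hasDerivAt_pow (2 * T + 2) (Y k l)).div_const (2 * T + 2 : ℝ)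
        simp only [Function.update_self]
        refine h1.congr_deriv ?_
        have : (2 * T + 2 : ℝ) ≠ 0 := by positivity
        push_cast
        field_simp
      · simp only [Function.update_of_ne hl]
        exact hasDerivAt_const _ _
    have := HasDerivAt.fun_sum (u := Finset.univ) fun l _ => e l
    simpa using this
  have hd := hdV.add ((hasDerivAt_pderiv F (Y k) i).const_mul ((k:ℝ) + 1))
  exact hloc2.hasDerivAt_eq_zero hd

theorem elim_poly {n : ℕ} (F : MvPolynomial (Fin n) (Polynomial ℝ)) (j : Fin n) :
    ∃ P : Polynomial (Polynomial ℝ), P ≠ 0 ∧ ∀ (μ : ℝ) (x : Fin n → ℝ) (δ : ℝ), 0 < δ →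
      MvPolynomial.eval x (MvPolynomial.map (Polynomial.evalRingHom μ) F) = 0 →
      (∀ y, 0 ≤ MvPolynomial.eval y (MvPolynomial.map (Polynomial.evalRingHom μ) F)) →
      (∀ y, dist y x ≤ δ →
        MvPolynomial.eval y (MvPolynomial.map (Polynomial.evalRingHom μ) F) = 0 → y = x) →
      P.eval₂ (Polynomial.evalRingHom μ) (x j) = 0 := by
  classical
  let T := ∑ i, (MvPolynomial.pderiv i F).totalDegree
  let W := {v : ℝ × ℝ × (Fin n → ℝ) // ∀ i, v.2.2 i ^ (2 * T + 1) + v.2.1 *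
    MvPolynomial.eval v.2.2 (MvPolynomial.pderiv i (MvPolynomial.map (Polynomial.evalRingHom v.1) F)) = 0}
  let ev : W → (Polynomial (Polynomial ℝ) →+* ℝ) := fun w => Polynomial.eval₂RingHom (Polynomial.evalRingHom w.1.1) w.1.2.1
  let φ : Polynomial (Polynomial ℝ) →+* (W → ℝ) := RingHom.pi ev
  letI : Algebra (Polynomial (Polynomial ℝ)) (W → ℝ) := φ.toAlgebra
  let y : Fin n → W → ℝ := fun i w => w.1.2.2 i
  let G : Fin n → MvPolynomial (Fin n) (Polynomial (Polynomial ℝ)) := fun i =>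
    MvPolynomial.C (-(Polynomial.X : Polynomial (Polynomial ℝ))) * MvPolynomial.map Polynomial.C (MvPolynomial.pderiv i F)
  have hG : ∀ i, (G i).totalDegree < 2 * T + 1 := fun i => by
    have h1 : (MvPolynomial.pderiv i F).totalDegree ≤ T :=
      Finset.single_le_sum (f := fun i => (MvPolynomial.pderiv i F).totalDegree)
        (fun _ _ => Nat.zero_le _) (Finset.mem_univ i)
    have h2 := MvPolynomial.totalDegree_mul (MvPolynomial.C (-(Polynomial.X : Polynomial (Polynomial ℝ))))
      (MvPolynomial.map Polynomial.C (MvPolynomial.pderiv i F))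
    rw [MvPolynomial.totalDegree_C] at h2
    have h3 : (MvPolynomial.map (Polynomial.C : Polynomial ℝ →+* Polynomial (Polynomial ℝ))
        (MvPolynomial.pderiv i F)).totalDegree ≤ (MvPolynomial.pderiv i F).totalDegree :=
      Finset.sup_mono (MvPolynomial.support_map_subset _ _)
    simp only [G]
    omega
  have hy : ∀ i, y i ^ (2 * T + 1) = MvPolynomial.aeval y (G i) := fun i => by
    funext w
    have hw := w.2 i
    have h1 : (MvPolynomial.aeval y (G i)) w =
        MvPolynomial.eval₂Hom (ev w) w.1.2.2 (G i) := by
      have := MvPolynomial.map_aeval y (Pi.evalRingHom (fun _ : W => ℝ) w) (G i)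
      exact this
    have hc : (ev w).comp Polynomial.C = Polynomial.evalRingHom w.1.1 := by
      ext <;> simp [ev]
    rw [h1]
    simp only [G, map_mul]
    rw [MvPolynomial.coe_eval₂Hom, MvPolynomial.eval₂_C, MvPolynomial.eval₂_map, hc]
    rw [MvPolynomial.pderiv_map, MvPolynomial.eval_map] at hw
    have hX : ev w (-(Polynomial.X : Polynomial (Polynomial ℝ))) = - w.1.2.1 := by simp [ev]
    rw [hX]
    change w.1.2.2 i ^ (2 * T + 1) = _
    linarith
  obtain ⟨χ, hmon, hχ⟩ := integral_of_pow n (2 * T + 1) y G hG hy j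
  have hχw : ∀ w : W, χ.eval₂ (ev w) (w.1.2.2 j) = 0 := fun w => by
    have := congrArg (Pi.evalRingHom (fun _ : W => ℝ) w) hχ
    rw [Polynomial.hom_eval₂] at this
    exact this
  let K := χ.support.sup fun i => (χ.coeff i).natDegree
  have hK : ∀ i, (χ.coeff i).natDegree ≤ K := fun i => by
    by_cases hi : i ∈ χ.support
    · exact Finset.le_sup (f := fun i => (χ.coeff i).natDegree) hi
    · rw [Polynomial.notMem_support_iff.1 hi]; simp
  let D := χ.natDegree + 1
  let P : Polynomial (Polynomial ℝ) :=
    ∑ i ∈ Finset.range D, Polynomial.monomial i ((χ.coeff i).coeff K)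
  have hPe : ∀ μ t, P.eval₂ (Polynomial.evalRingHom μ) t =
      ∑ i ∈ Finset.range D, ((χ.coeff i).coeff K).eval μ * t ^ i := fun μ t => by
    simp [P, Polynomial.eval₂_finsetSum, Polynomial.eval₂_monomial]
  refine ⟨P, ?_, ?_⟩
  · intro hP0
    have hne : χ.support.Nonempty := by
      rw [Polynomial.support_nonempty]; exact hmon.ne_zero
    obtain ⟨i, hi, hiK⟩ := Finset.exists_mem_eq_sup χ.support hne fun i => (χ.coeff i).natDegree
    have hc : P.coeff i = (χ.coeff i).coeff K := by
      have : i < D := Nat.lt_succ_of_le (Polynomial.le_natDegree_of_mem_supp i hi)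
      simp only [P, Polynomial.finsetSum_coeff, Polynomial.coeff_monomial]
      rw [Finset.sum_ite_eq' ]
      simp [this]
    rw [hP0, Polynomial.coeff_zero] at hc
    have hKi : K = (χ.coeff i).natDegree := hiK
    rw [hKi, Polynomial.coeff_natDegree] at hc
    exact Polynomial.mem_support_iff.1 hi (Polynomial.leadingCoeff_eq_zero.1 hc.symm)
  · intro μ x δ hδ h0 hnn hiso
    obtain ⟨Y, hYt, hYe⟩ := crit_seq _ T x δ hδ h0 hnn hiso
    have hηlim : Tendsto (fun k : ℕ => ((k:ℝ) + 1)⁻¹) atTop (𝓝 0) := by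
      simpa using tendsto_one_div_add_atTop_nhds_zero_nat (𝕜 := ℝ)
    have hYj : Tendsto (fun k => Y k j) atTop (𝓝 (x j)) := (tendsto_pi_nhds.1 hYt) j
    let Ψ : ℝ → ℝ → ℝ := fun η t => ∑ i ∈ Finset.range D,
      (Polynomial.reflect K (χ.coeff i)).eval₂ (Polynomial.evalRingHom μ) η * t ^ i
    have hlim : Tendsto (fun k : ℕ => Ψ ((k:ℝ) + 1)⁻¹ (Y k j)) atTop (𝓝 (Ψ 0 (x j))) := by
      refine tendsto_finsetSum _ fun i _ => Tendsto.mul ?_ (hYj.pow i)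
      have hc : Continuous fun η : ℝ =>
          (Polynomial.reflect K (χ.coeff i)).eval₂ (Polynomial.evalRingHom μ) η :=
        Polynomial.continuous_eval₂ _ _
      exact (hc.tendsto 0).comp hηlim
    have hzero : ∀ᶠ k : ℕ in atTop, Ψ ((k:ℝ) + 1)⁻¹ (Y k j) = 0 := by
      filter_upwards [hYe] with k hk
      have hpos : (0:ℝ) < (k:ℝ) + 1 := by positivity
      have h1 := hχw ⟨(μ, (k:ℝ) + 1, Y k), hk⟩
      rw [Polynomial.eval₂_eq_sum_range] at h1
      refine (mul_eq_zero.1 ?_).resolve_right (pow_pos hpos K).ne'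
      rw [← h1, Finset.sum_mul]
      refine Finset.sum_congr rfl fun i _ => ?_
      letI := invertibleOfNonzero hpos.ne'
      have h2 := Polynomial.eval₂_reflect_mul_pow (Polynomial.evalRingHom μ) ((k:ℝ) + 1) K
        (χ.coeff i) (hK i)
      rw [invOf_eq_inv] at h2
      have h3 : ev ⟨(μ, (k:ℝ) + 1, Y k), hk⟩ (χ.coeff i) =
        Polynomial.eval₂ (Polynomial.evalRingHom μ) ((k:ℝ) + 1) (χ.coeff i) := rfl
      rw [h3, ← h2]; ring
    have hΨ0 : Ψ 0 (x j) = 0 :=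
      tendsto_nhds_unique hlim (tendsto_const_nhds.congr' (hzero.mono fun t h => h.symm))
    rw [hPe, ← hΨ0]
    refine Finset.sum_congr rfl fun i _ => ?_
    congr 1
    rw [← Polynomial.eval_map, ← Polynomial.coeff_zero_eq_eval_zero, Polynomial.coeff_map,
      Polynomial.coeff_reflect]
    simp [Polynomial.revAt_le]
end PartA

open MvPolynomial

/-- cleared equation -/
noncomputable def clearedEq {n r : ℕ} (f : MvPolynomial (Fin n) ℝ)
    (g : Fin r → MvPolynomial (Fin n) ℝ) (j : Fin n) : MvPolynomial (Fin n) (Polynomial ℝ) :=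
  map Polynomial.C (pderiv j f * ∏ i, g i) -
    C Polynomial.X * map Polynomial.C (∑ i, pderiv j (g i) * ∏ k ∈ Finset.univ.erase i, g k)

theorem clearedEq_eval {n r : ℕ} (f : MvPolynomial (Fin n) ℝ)
    (g : Fin r → MvPolynomial (Fin n) ℝ) (j : Fin n) (μ : ℝ) (y : Fin n → ℝ)
    (hy : ∀ i, 0 < eval y (g i)) :
    eval y (map (Polynomial.evalRingHom μ) (clearedEq f g j)) = 0 ↔
      eval y (pderiv j f) = μ * ∑ i, eval y (pderiv j (g i)) / eval y (g i) := by
  have hid : (Polynomial.evalRingHom μ).comp Polynomial.C = RingHom.id ℝ := by ext <;> simp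
  have hprod : (∏ i, eval y (g i)) ≠ 0 := Finset.prod_ne_zero_iff.2 fun i _ => (hy i).ne'
  have e : eval y (map (Polynomial.evalRingHom μ) (clearedEq f g j)) =
      (eval y (pderiv j f) - μ * ∑ i, eval y (pderiv j (g i)) / eval y (g i)) *
        ∏ i, eval y (g i) := by
    simp only [clearedEq, map_sub, map_mul (map (Polynomial.evalRingHom μ)), map_map, hid, map_id,
      map_C, eval_C, map_mul (eval y), map_sum (eval y), map_prod (eval y), map_add, sub_mul, mul_assoc,
      Polynomial.coe_evalRingHom, Polynomial.eval_X, Finset.sum_mul]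
    congr 2
    refine Finset.sum_congr rfl fun i _ => ?_
    rw [← Finset.mul_prod_erase _ _ (Finset.mem_univ i)]
    have := (hy i).ne'
    field_simp
  rw [e, mul_eq_zero, or_iff_left hprod, sub_eq_zero]

/-- A bounded critical path `x(μ)` of the log-barrier function of a
polynomial optimization problem admits an analytic reparametrization: for some positive
integer `ρ`, the map `μ ↦ x(μ^ρ)` extends to a real-analytic map on an interval `(−ε,ε)`. -/
theorem bounded_critical_path_analytic_reparam (n r : ℕ) (f : MvPolynomial (Fin n) ℝ)
    (g : Fin r → MvPolynomial (Fin n) ℝ) (μ0 : ℝ) (hμ0 : 0 < μ0)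
    (x : ℝ → Fin n → ℝ) (hcont : ContinuousOn x (Set.Ioo 0 μ0))
    (hbdd : ∃ R : ℝ, ∀ μ ∈ Set.Ioo (0 : ℝ) μ0, ‖x μ‖ ≤ R)
    (hpath : ∀ μ ∈ Set.Ioo (0 : ℝ) μ0,
      (∀ i, 0 < eval (x μ) (g i)) ∧
      (∀ j, eval (x μ) (pderiv j f) =
        μ * ∑ i, eval (x μ) (pderiv j (g i)) / eval (x μ) (g i)) ∧
      ∃ δ > (0 : ℝ), ∀ y : Fin n → ℝ,
        ((∀ i, 0 < eval y (g i)) ∧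
          ∀ j, eval y (pderiv j f) = μ * ∑ i, eval y (pderiv j (g i)) / eval y (g i)) →
        dist y (x μ) < δ → y = x μ) :
    ∃ ρ : ℕ, 0 < ρ ∧ ∃ ε > (0 : ℝ), ∃ y : ℝ → Fin n → ℝ,
      AnalyticOnNhd ℝ y (Set.Ioo (-ε) ε) ∧
      ∀ μ ∈ Set.Ioo (0 : ℝ) ε, μ ^ ρ < μ0 ∧ y μ = x (μ ^ ρ) := by
  classical
  obtain ⟨B, hB⟩ := hbdd
  let F : MvPolynomial (Fin n) (Polynomial ℝ) := ∑ j, clearedEq f g j ^ 2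
  have hFe : ∀ μ y, eval y (map (Polynomial.evalRingHom μ) F) =
      ∑ j, eval y (map (Polynomial.evalRingHom μ) (clearedEq f g j)) ^ 2 := fun μ y => by
    simp [F]
  have hFnn : ∀ μ y, 0 ≤ eval y (map (Polynomial.evalRingHom μ) F) := fun μ y => by
    rw [hFe]; positivity
  have hF0 : ∀ μ y, (∀ i, 0 < eval y (g i)) → (eval y (map (Polynomial.evalRingHom μ) F) = 0 ↔
      ∀ j, eval y (pderiv j f) = μ * ∑ i, eval y (pderiv j (g i)) / eval y (g i)) := by
    intro μ y hy
    rw [hFe, Finset.sum_eq_zero_iff_of_nonneg (fun _ _ => sq_nonneg _)]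
    refine ⟨fun h j => ?_, fun h j _ => ?_⟩
    · exact (clearedEq_eval f g j μ y hy).1 (pow_eq_zero_iff two_ne_zero |>.1 (h j (Finset.mem_univ j)))
    · rw [(clearedEq_eval f g j μ y hy).2 (h j)]; simp
  have hI : Set.Ioo (0:ℝ) μ0 ∈ nhdsWithin (0:ℝ) (Set.Ioi 0) := Ioo_mem_nhdsGT hμ0
  have hmain : ∀ j : Fin n, ∃ ρ : ℕ, 0 < ρ ∧ ∃ H : ℝ → ℝ, AnalyticAt ℝ H 0 ∧
      ∀ᶠ t in nhdsWithin (0:ℝ) (Set.Ioi 0), x (t ^ ρ) j = H t := by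
    intro j
    obtain ⟨P, hP, hPr⟩ := elim_poly F j
    refine puiseux P hP (fun t => x t j) ?_ B ?_ ?_
    · filter_upwards [hI] with t ht
      exact (continuous_apply j).continuousAt.comp (hcont.continuousAt (isOpen_Ioo.mem_nhds ht))
    · filter_upwards [hI] with t ht
      exact (norm_le_pi_norm (x t) j).trans (hB t ht)
    · filter_upwards [hI] with t ht
      obtain ⟨hpos, heq, δ, hδ, hiso⟩ := hpath t ht
      have hopen : {y : Fin n → ℝ | ∀ i, 0 < eval y (g i)} ∈ nhds (x t) := by
        refine Filter.eventually_all.2 fun i => ?_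
        exact (isOpen_lt continuous_const (MvPolynomial.continuous_eval (g i))).mem_nhds (hpos i)
      obtain ⟨δ', hδ', hsub⟩ := Metric.mem_nhds_iff.1 hopen
      refine hPr t (x t) (min δ δ' / 2) (by positivity) ((hF0 t _ hpos).2 heq) (hFnn t) ?_
      intro y hy hy0
      have hlt : min δ δ' / 2 < min δ δ' := half_lt_self (lt_min hδ hδ')
      have hyp : ∀ i, 0 < eval y (g i) :=
        hsub (Metric.mem_ball.2 (lt_of_le_of_lt hy (hlt.trans_le (min_le_right _ _))))
      exact hiso y ⟨hyp, (hF0 t y hyp).1 hy0⟩ (lt_of_le_of_lt hy (hlt.trans_le (min_le_left _ _)))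
  choose ρ hρ H hH he using hmain
  let Q : ℕ := ∏ j, ρ j
  have hQ : 0 < Q := Finset.prod_pos fun j _ => hρ j
  let σ : Fin n → ℕ := fun j => ∏ i ∈ Finset.univ.erase j, ρ i
  have hσ : ∀ j, 0 < σ j := fun j => Finset.prod_pos fun i _ => hρ i
  have hσQ : ∀ j, σ j * ρ j = Q := fun j => Finset.prod_erase_mul _ _ (Finset.mem_univ j)
  let Y : ℝ → Fin n → ℝ := fun t j => H j (t ^ σ j)
  have hY : AnalyticAt ℝ Y 0 := analyticAt_pi_iff.2 fun j => an_comp_pow (hH j) (hσ j)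
  have hYe : ∀ᶠ t in nhdsWithin (0:ℝ) (Set.Ioi 0), ∀ j, x (t ^ Q) j = H j (t ^ σ j) := by
    refine Filter.eventually_all.2 fun j => ?_
    filter_upwards [(tendsto_pow_nhdsGT (hσ j)).eventually (he j)] with t ht
    rw [← ht, ← pow_mul, hσQ]
  have h1 := hY.eventually_analyticAt
  have h2 := hYe.and ((tendsto_pow_nhdsGT hQ).eventually hI)
  rw [eventually_nhdsWithin_iff] at h2
  obtain ⟨ε, hε, hall⟩ := Metric.eventually_nhds_iff.1 (h1.and h2)
  refine ⟨Q, hQ, ε, hε, Y, ?_, ?_⟩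
  · intro t ht
    exact (hall (y := t) (by rw [Real.dist_eq, sub_zero]; exact abs_lt.2 ht)).1
  · intro t ht
    have := (hall (y := t) (by rw [Real.dist_eq, sub_zero, abs_of_pos ht.1]; exact ht.2)).2 ht.1
    refine ⟨this.2.2, ?_⟩
    funext j
    exact (this.1 j).symm
end
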